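/- arXiv:1407.3516 — 2 statements merged into one kernel-verified Lean document; each statement's English description precedes it below -/
import Mathlib

section
/- Let x, w, v, q be real numbers with 0 < x < 1/4, 0 < w ≤ 1, 0 < v ≤ 1, 0 < q < 1, and set t₀ = 1/(2√x), A(x,u) = x·u/(1 − x·u·C(x)), L_0(x,w) = 1/(1−x·w) and L_j(x,w) = 1/(1 − x·L_{j−1}(x,w)) for j ≥ 1. Then the quadruple series Σ_{i≥1} Σ_{s≥1} Σ_{t≥1} Σ_{n} a_i(n,s,t)·x^n·w^t·v^s·q^i converges and equals q·Σ_{j≥0} [ w·√x·q^j·( A(x, v·L_j(x,w)) − A(x,v) − D ) ] / ( (U_{j+1}(t₀) − w√x·U_j(t₀))·(U_j(t₀) − w√x·U_{j−1}(t₀)) ), where D = [ q·Σ_{i≥0} q^i·( A(x, v·L_i(x,1)) − A(x,v) )/( √x·U_{i+2}(t₀)·U_{i+1}(t₀) ) ] / [ 1 + q·Σ_{i≥0} q^i/( √x·U_{i+2}(t₀)·U_{i+1}(t₀) ) ]. -/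
/-- A Catalan word: a word `a : Fin n → ℕ` satisfying (i) `a (i+1) ≥ a i - 1` for all
adjacent positions, and (ii) if `i` is the minimal index with `a i = k > 0`, then there
exist `i₁ < i < i₂` with `a i₁ = a i₂ = k - 1`. -/
def IsCatalanWord {n : ℕ} (a : Fin n → ℕ) : Prop :=
  (∀ (i : ℕ) (h : i + 1 < n), a ⟨i, Nat.lt_of_succ_lt h⟩ ≤ a ⟨i + 1, h⟩ + 1) ∧
  (∀ i : Fin n, 0 < a i → (∀ j : Fin n, a j = a i → i ≤ j) →
    ((∃ i₁ : Fin n, i₁ < i ∧ a i₁ + 1 = a i) ∧ (∃ i₂ : Fin n, i < i₂ ∧ a i₂ + 1 = a i)))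

/-- The number of letters of the word `a` equal to `c`. -/
noncomputable def countEq {n : ℕ} (a : Fin n → ℕ) (c : ℕ) : ℕ :=
  Set.ncard {i : Fin n | a i = c}

/-- `numLet i n s t` is the number of Catalan words of length `n` containing exactly `s`
letters equal to `i` and exactly `t` letters equal to `0`. -/
noncomputable def numLet (i n s t : ℕ) : ℕ :=
  Set.ncard {a : Fin n → ℕ | IsCatalanWord a ∧ countEq a i = s ∧ countEq a 0 = t}

/-- `C(x) = (1 - √(1-4x))/(2x)`, the generating function of the Catalan numbers. -/
noncomputable def Cfun (x : ℝ) : ℝ := (1 - Real.sqrt (1 - 4*x)) / (2*x)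

/-- Evaluation at `t` of the `n`-th Chebyshev polynomial of the second kind, with the
index extended to all integers by the recurrence `U n = 2x·U (n-1) - U (n-2)`
(so `U (-1) = 0`). -/
noncomputable def chebU (n : ℤ) (t : ℝ) : ℝ := (Polynomial.Chebyshev.U ℝ n).eval t

/-- `Lfun x w j = L_j(x,w)`, where `L_0(x,w) = 1/(1-xw)` and
`L_j(x,w) = 1/(1 - x·L_{j-1}(x,w))` for `j ≥ 1`. -/
noncomputable def Lfun (x w : ℝ) : ℕ → ℝ
  | 0 => 1 / (1 - x * w)
  | j + 1 => 1 / (1 - x * Lfun x w j)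

/-- `A(x,u) = xu/(1 - xu·C(x))`. -/
noncomputable def Afun (x u : ℝ) : ℝ := x * u / (1 - x * u * Cfun x)

namespace CatalanSeries
open scoped ENNReal Classical

/-- The word obtained by deleting the letters `0` and lowering all other letters by one. -/
def peel (l : List ℕ) : List ℕ := l.filterMap Nat.ppred

/-- Adjacent letters drop by at most one. -/
def Slow (l : List ℕ) : Prop := l.IsChain (fun p c => p ≤ c + 1)

lemma slow_cons_cons {p c : ℕ} {l : List ℕ} :
    Slow (p :: c :: l) ↔ p ≤ c + 1 ∧ Slow (c :: l) :=
  List.isChain_cons_cons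

/-- The first occurrence of a positive letter lies between two occurrences of its predecessor. -/
def Nested (l : List ℕ) : Prop :=
  ∀ k l₁ l₂, l = l₁ ++ (k + 1) :: l₂ → k + 1 ∉ l₁ → k ∈ l₁ ∧ k ∈ l₂

/-- Catalan words as lists. -/
def IsCat (l : List ℕ) : Prop := Slow l ∧ Nested l

@[simp] lemma peel_nil : peel [] = [] := rfl

@[simp] lemma peel_zero_cons (l : List ℕ) : peel (0 :: l) = peel l := rfl

@[simp] lemma peel_succ_cons (c : ℕ) (l : List ℕ) : peel ((c + 1) :: l) = c :: peel l := rfl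

@[simp] lemma peel_append (l l' : List ℕ) : peel (l ++ l') = peel l ++ peel l' := by
  simp [peel]

@[simp] lemma peel_replicate_zero (m : ℕ) : peel (List.replicate m 0) = [] := by
  induction m with
  | zero => rfl
  | succ m ih => simpa [List.replicate_succ] using ih

@[simp] lemma mem_peel {k : ℕ} {l : List ℕ} : k ∈ peel l ↔ k + 1 ∈ l := by
  induction l with
  | nil => simp
  | cons c l ih => cases c <;> simp [ih]

@[simp] lemma peel_map_succ (l : List ℕ) : peel (l.map Nat.succ) = l := by
  induction l with
  | nil => rfl
  | cons c l ih => simpa using ih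

lemma map_succ_peel {l : List ℕ} (h : 0 ∉ l) : (peel l).map Nat.succ = l := by
  induction l with
  | nil => rfl
  | cons c l ih => cases c <;> simp_all

lemma slow_map_succ {l : List ℕ} : Slow (l.map Nat.succ) ↔ Slow l := by
  simp [Slow, List.isChain_map]

lemma length_eq_count_add_length_peel (l : List ℕ) :
    l.length = l.count 0 + (peel l).length := by
  induction l with
  | nil => simp
  | cons c l ih => cases c <;> simp [ih] <;> omega

lemma count_peel (i : ℕ) (l : List ℕ) : (peel l).count i = l.count (i + 1) := by
  induction l with
  | nil => simp
  | cons c l ih => cases c <;> simp [ih, List.count_cons]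

lemma exists_eq_of_peel_eq_nil {l : List ℕ} (h : peel l = []) :
    ∃ m, l = List.replicate m 0 := by
  induction l with
  | nil => exact ⟨0, rfl⟩
  | cons c l ih =>
    cases c with
    | zero => obtain ⟨m, rfl⟩ := ih h; exact ⟨m + 1, rfl⟩
    | succ c => simp at h

lemma exists_eq_of_peel_eq_cons {l b' : List ℕ} {b : ℕ} (h : peel l = b :: b') :
    ∃ m a, l = List.replicate m 0 ++ (b + 1) :: a ∧ peel a = b' := by
  induction l with
  | nil => simp at h
  | cons c l ih =>
    cases c with
    | zero => obtain ⟨m, a, rfl, ha⟩ := ih h; exact ⟨m + 1, a, rfl, ha⟩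
    | succ c =>
      simp only [peel_succ_cons, List.cons.injEq] at h
      exact ⟨0, l, by simp [h.1], h.2⟩

lemma exists_split_of_peel {l b₁ b₂ : List ℕ} {k : ℕ} (h : peel l = b₁ ++ k :: b₂) :
    ∃ l₁ l₂, l = l₁ ++ (k + 1) :: l₂ ∧ peel l₁ = b₁ ∧ peel l₂ = b₂ := by
  obtain ⟨l₁, l', rfl, h₁, h'⟩ := List.filterMap_eq_append_iff.1 h
  obtain ⟨m, a, rfl, ha⟩ := exists_eq_of_peel_eq_cons h'
  exact ⟨l₁ ++ List.replicate m 0, a, by simp, by rw [← h₁]; simp [peel.eq_1 l₁], ha⟩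

lemma replicate_append_cons_injective (c : ℕ) :
    Function.Injective
      (fun p : ℕ × List ℕ => List.replicate p.1 0 ++ (c + 1) :: p.2) := by
  rintro ⟨m, a⟩ ⟨m', a'⟩ h
  dsimp only at h
  induction m generalizing m' with
  | zero => cases m' <;> simp_all [List.replicate_succ]
  | succ m ih =>
    cases m' with
    | zero => simp [List.replicate_succ] at h
    | succ m' =>
      simp only [List.replicate_succ, List.cons_append, List.cons.injEq, true_and] at h
      have := ih m' h
      simp_all

lemma slow_one_cons_replicate (m c : ℕ) (a : List ℕ) :
    Slow (1 :: (List.replicate m 0 ++ (c + 1) :: a)) ↔ Slow ((c + 1) :: a) := by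
  have h0 : ∀ m, Slow (0 :: (List.replicate m 0 ++ (c + 1) :: a)) ↔ Slow ((c + 1) :: a) := by
    intro m
    induction m with
    | zero => simp [Slow]
    | succ m ih => simpa [Slow, List.replicate_succ] using ih
  cases m with
  | zero => simp [Slow]
  | succ m => simpa [Slow, List.replicate_succ] using h0 m

lemma slow_replicate (m c : ℕ) (a : List ℕ) :
    Slow (List.replicate m 0 ++ (c + 1) :: a) ↔ Slow ((c + 1) :: a) := by
  cases m with
  | zero => simp
  | succ m =>
    rw [← slow_one_cons_replicate (m + 1)]
    simp [Slow, List.replicate_succ]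

lemma slow_one_replicate (m : ℕ) : Slow (1 :: List.replicate m 0) := by
  induction m with
  | zero => simp [Slow]
  | succ m ih =>
    cases m <;> simp_all [Slow, List.replicate_succ]

lemma tsum_eq_tsum_replicate_append (c : ℕ) (f : List ℕ → ℝ≥0∞)
    (hf : ∀ a, f a ≠ 0 → ∃ b, peel a = c :: b) :
    ∑' a, f a = ∑' (m : ℕ) (a : List ℕ), f (List.replicate m 0 ++ (c + 1) :: a) := by
  rw [← (replicate_append_cons_injective c).tsum_eq,
    ENNReal.tsum_prod (f := fun m a => f (List.replicate m 0 ++ (c + 1) :: a))]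
  intro a ha
  obtain ⟨b, hb⟩ := hf a ha
  obtain ⟨m, a, rfl, -⟩ := exists_eq_of_peel_eq_cons hb
  exact ⟨(m, a), rfl⟩

lemma tsum_fiber (y : ℝ≥0∞) (b : List ℕ) (p : ℕ) :
    ∑' a : List ℕ, (if peel a = b ∧ Slow ((p + 1) :: a) then y ^ a.count 0 else 0) =
      if Slow (p :: b) then (1 - y)⁻¹ ^ (p :: b).count 0 else 0 := by
  induction b generalizing p with
  | nil =>
    cases p with
    | zero =>
      have hinj : Function.Injective (fun m : ℕ => List.replicate m 0) :=
        fun m m' h => by simpa using congrArg List.length h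
      rw [← hinj.tsum_eq]
      · simp only [peel_replicate_zero, Nat.zero_add, slow_one_replicate, and_self, if_true,
          List.count_replicate_self, ENNReal.tsum_geometric]
        simp [Slow]
      · intro a ha
        simp only [Function.mem_support, ne_eq, ite_eq_right_iff, not_forall] at ha
        obtain ⟨m, rfl⟩ := exists_eq_of_peel_eq_nil ha.1.1
        exact ⟨m, rfl⟩
    | succ p =>
      rw [tsum_eq_single []]
      · simp [Slow]
      · intro a ha
        rw [if_neg]
        rintro ⟨h, hs⟩
        obtain ⟨m, rfl⟩ := exists_eq_of_peel_eq_nil h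
        cases m <;> simp_all [Slow, List.replicate_succ]
  | cons c b ih =>
    rw [tsum_eq_tsum_replicate_append c]
    · cases p with
      | zero =>
        have := ih c
        simp only [Nat.zero_add, slow_one_cons_replicate, peel_append, peel_replicate_zero,
          peel_succ_cons, List.nil_append, List.cons.injEq, true_and, List.count_append,
          List.count_replicate_self, pow_add]
        have e : ∀ (m : ℕ) (a : List ℕ), (if peel a = b ∧ Slow ((c + 1) :: a) then
            y ^ m * y ^ ((c + 1) :: a).count 0 else 0) =
            y ^ m * (if peel a = b ∧ Slow ((c + 1) :: a) then y ^ a.count 0 else 0) := by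
          intro m a
          split_ifs <;> simp
        simp only [e, ENNReal.tsum_mul_left, ENNReal.tsum_mul_right, this,
          ENNReal.tsum_geometric]
        have : Slow (0 :: c :: b) ↔ Slow (c :: b) := by simp [Slow]
        simp only [this, mul_ite, mul_zero]
        congr 1
        rw [List.count_cons_self, pow_succ']
      | succ p =>
        have := ih c
        rw [tsum_eq_single 0]
        · have e : ∀ a : List ℕ, (if peel (List.replicate 0 0 ++ (c + 1) :: a) = c :: b ∧
            Slow ((p + 1 + 1) :: (List.replicate 0 0 ++ (c + 1) :: a)) then
            y ^ (List.replicate 0 0 ++ (c + 1) :: a).count 0 else 0) =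
            (if p ≤ c then 1 else 0) *
              (if peel a = b ∧ Slow ((c + 1) :: a) then y ^ a.count 0 else 0) := by
            intro a
            by_cases h : p ≤ c <;> simp [slow_cons_cons, h]
          simp only [e, ENNReal.tsum_mul_left, this]
          by_cases h : p ≤ c <;> simp [slow_cons_cons, h]
        · intro m hm
          obtain ⟨m, rfl⟩ := Nat.exists_eq_succ_of_ne_zero hm
          simp [Slow, List.replicate_succ]
    · intro a ha
      simp only [ne_eq, ite_eq_right_iff, not_forall] at ha
      exact ⟨b, ha.1.1⟩

lemma Slow.peel_of_succ_cons {p : ℕ} {l : List ℕ} (h : Slow ((p + 1) :: l)) :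
    Slow (p :: peel l) := by
  by_contra hp
  have h0 := tsum_fiber 1 (peel l) p
  rw [if_neg hp, ENNReal.tsum_eq_zero] at h0
  simpa [h] using h0 l

lemma Nested.peel {l : List ℕ} (h : Nested l) : Nested (peel l) := by
  intro k b₁ b₂ hb hk
  obtain ⟨l₁, l₂, rfl, rfl, rfl⟩ := exists_split_of_peel hb
  simpa using h (k + 1) l₁ l₂ rfl (by simpa using hk)

lemma Nested.eq_zero_cons {c : ℕ} {l : List ℕ} (h : Nested (c :: l)) : c = 0 := by
  cases c with
  | zero => rfl
  | succ c => simpa using (h c [] l rfl (by simp)).1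

lemma isCat_replicate_append {m : ℕ} {a : List ℕ} :
    IsCat (List.replicate m 0 ++ 1 :: a) ↔
      IsCat (0 :: peel a) ∧ Slow (1 :: a) ∧ 0 ∈ a ∧ m ≠ 0 := by
  constructor
  · rintro ⟨hs, hn⟩
    have hs' : Slow (1 :: a) := (slow_replicate m 0 a).1 hs
    have h1 := hn 0 (List.replicate m 0) a rfl (by simp [List.mem_replicate])
    refine ⟨⟨hs'.peel_of_succ_cons, ?_⟩, hs', h1.2, by rintro rfl; simpa using h1.1⟩
    simpa using hn.peel
  · rintro ⟨⟨hs, hn⟩, hs', h0, hm⟩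
    refine ⟨(slow_replicate m 0 a).2 hs', ?_⟩
    intro k l₁ l₂ hl hk
    cases k with
    | zero =>
      have := replicate_append_cons_injective 0
      have hc : peel l₁ = [] := by
        have hp := congrArg peel hl
        cases hq : peel l₁ with
        | nil => rfl
        | cons c t =>
          have hc : c = 0 := by
            simp only [peel_append, peel_replicate_zero, List.nil_append] at hp
            rw [hq] at hp
            have h1 := peel_succ_cons 0 a
            rw [Nat.zero_add] at h1
            rw [h1] at hp
            simp only [List.cons_append, List.cons.injEq] at hp
            exact hp.1.symm
          exact absurd (mem_peel.1 (by rw [hq, hc]; simp)) hk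
      obtain ⟨m', rfl⟩ := exists_eq_of_peel_eq_nil hc
      have := @this (m, a) (m', l₂) hl
      simp only [Prod.mk.injEq] at this
      obtain ⟨rfl, rfl⟩ := this
      exact ⟨by simp [List.mem_replicate, hm], h0⟩
    | succ k =>
      have hp := congrArg peel hl
      simp only [peel_append, peel_replicate_zero, List.nil_append, peel_succ_cons] at hp
      simpa using hn k _ _ hp (by simpa using hk)

/-- Summing over the ways to insert zeros into a given Catalan word. -/
lemma tsum_isCat_peel (y : ℝ≥0∞) (h : List ℕ → ℝ≥0∞) :
    ∑' a, (if IsCat a ∧ peel a ≠ [] then y ^ a.count 0 * h (peel a) else 0) +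
      y * (1 - y)⁻¹ * ∑' b, (if IsCat b ∧ b ≠ [] then h b else 0) =
    y * (1 - y)⁻¹ * ∑' b, (if IsCat b ∧ b ≠ [] then (1 - y)⁻¹ ^ b.count 0 * h b else 0) := by
  have key : ∀ g : List ℕ → ℝ≥0∞, ∑' b, (if IsCat b ∧ b ≠ [] then g b else 0) =
      ∑' b, (if IsCat (0 :: b) then g (0 :: b) else 0) := by
    intro g
    rw [← (List.cons_injective (a := 0)).tsum_eq]
    · simp
    · intro b hb
      simp only [Function.mem_support, ne_eq, ite_eq_right_iff, not_forall] at hb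
      obtain ⟨⟨hc, hne⟩, -⟩ := hb
      cases b with
      | nil => simp at hne
      | cons c b => exact ⟨b, by rw [hc.2.eq_zero_cons]⟩
  have hsum : ∑' m : ℕ, (if m ≠ 0 then y ^ m else 0) = y * (1 - y)⁻¹ := by
    rw [tsum_eq_zero_add' ENNReal.summable]
    simp [pow_succ', ENNReal.tsum_mul_left, ENNReal.tsum_geometric]
  have hfib : ∑' a, (if IsCat a ∧ peel a ≠ [] then y ^ a.count 0 * h (peel a) else 0) =
      y * (1 - y)⁻¹ * ∑' b, (if IsCat (0 :: b) then h (0 :: b) *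
        ∑' a, (if peel a = b ∧ Slow (1 :: a) ∧ 0 ∈ a then y ^ a.count 0 else 0) else 0) := by
    rw [tsum_eq_tsum_replicate_append 0]
    · have e : ∀ m a, (if IsCat (List.replicate m 0 ++ (0 + 1) :: a) ∧
          peel (List.replicate m 0 ++ (0 + 1) :: a) ≠ [] then
          y ^ (List.replicate m 0 ++ (0 + 1) :: a).count 0 *
            h (peel (List.replicate m 0 ++ (0 + 1) :: a)) else 0) =
          (if m ≠ 0 then y ^ m else 0) * (if IsCat (0 :: peel a) ∧ Slow (1 :: a) ∧ 0 ∈ a then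
            y ^ a.count 0 * h (0 :: peel a) else 0) := by
        intro m a
        have := @isCat_replicate_append m a
        simp only [Nat.zero_add, this, peel_append, peel_replicate_zero, List.nil_append,
          peel_succ_cons 0 a, List.count_append, List.count_replicate_self]
        by_cases hm : m = 0
        · simp [hm]
        · by_cases hc : IsCat (0 :: peel a) ∧ Slow (1 :: a) ∧ 0 ∈ a
          · simp [hc, hm, pow_add, mul_assoc]
          · simp only [← and_assoc] at hc ⊢
            simp [hc]
      simp only [e, ENNReal.tsum_mul_left, ENNReal.tsum_mul_right, hsum]
      congr 1
      have e2 : ∀ b, (if IsCat (0 :: b) then h (0 :: b) * ∑' a : List ℕ,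
          (if peel a = b ∧ Slow (1 :: a) ∧ 0 ∈ a then y ^ a.count 0 else 0) else 0) =
          ∑' a : List ℕ, if b = peel a then
            (if IsCat (0 :: peel a) ∧ Slow (1 :: a) ∧ 0 ∈ a then
              y ^ a.count 0 * h (0 :: peel a) else 0) else 0 := by
        intro b
        split_ifs with hb
        · rw [← ENNReal.tsum_mul_left]
          congr 1; ext a
          by_cases hab : b = peel a
          · subst hab
            by_cases hs : Slow (1 :: a) ∧ 0 ∈ a <;> simp [hs, hb, mul_comm]
          · simp [hab, Ne.symm hab]
        · symm
          rw [ENNReal.tsum_eq_zero]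
          intro a
          by_cases hab : b = peel a
          · subst hab; simp [hb]
          · simp [hab]
      simp only [e2]
      rw [ENNReal.tsum_comm]
      congr 1; ext a
      rw [tsum_ite_eq (peel a)
        (fun _ => if IsCat (0 :: peel a) ∧ Slow (1 :: a) ∧ 0 ∈ a then
          y ^ a.count 0 * h (0 :: peel a) else 0)]
    · intro a ha
      simp only [ne_eq, ite_eq_right_iff, not_forall] at ha
      obtain ⟨⟨hc, hne⟩, -⟩ := ha
      cases hp : peel a with
      | nil => exact absurd hp hne
      | cons c b =>
        have := hc.2.peel
        rw [hp] at this
        exact ⟨b, by rw [this.eq_zero_cons]⟩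
  rw [hfib, key, key, ← mul_add, ← ENNReal.tsum_add]
  congr 2; ext b
  split_ifs with hb
  · have hf := tsum_fiber y b 0
    rw [if_pos hb.1] at hf
    have hz : ∑' a : List ℕ, (if peel a = b ∧ Slow (1 :: a) ∧ 0 ∉ a then y ^ a.count 0 else 0)
        = 1 := by
      rw [tsum_eq_single (b.map Nat.succ)]
      · have hs : Slow (1 :: b.map Nat.succ) := slow_map_succ.2 hb.1
        have h0 : 0 ∉ b.map Nat.succ := by simp
        rw [if_pos ⟨peel_map_succ b, hs, h0⟩, List.count_eq_zero_of_not_mem h0, pow_zero]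
      · intro a ha
        rw [if_neg]
        rintro ⟨rfl, -, h0⟩
        exact ha (map_succ_peel h0).symm
    rw [← hf, mul_comm _ (h _)]
    nth_rw 2 [← mul_one (h (0 :: b))]
    rw [← hz, ← mul_add, ← ENNReal.tsum_add]
    congr 2; ext a
    by_cases h0 : 0 ∈ a <;> simp [h0]
  · simp

/-- Generating function of nonempty Catalan words with all letters below `d`. -/
noncomputable def depthSum (x : ℝ≥0∞) (d : ℕ∞) (w : ℝ≥0∞) : ℝ≥0∞ :=
  ∑' a : List ℕ, if IsCat a ∧ a ≠ [] then
    w ^ a.count 0 * (if ∀ c ∈ a, (c : ℕ∞) < d then x ^ a.length else 0) else 0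

/-- Generating function of Catalan words containing the letter `i`. -/
noncomputable def letterSum (x v : ℝ≥0∞) (i : ℕ) (w : ℝ≥0∞) : ℝ≥0∞ :=
  ∑' a : List ℕ, if IsCat a ∧ a ≠ [] then
    w ^ a.count 0 * (if i ∈ a then x ^ a.length * v ^ a.count i else 0) else 0

lemma zero_mem_of_isCat {a : List ℕ} (h : IsCat a) (hne : a ≠ []) : 0 ∈ a := by
  cases a with
  | nil => exact absurd rfl hne
  | cons c a => rw [h.2.eq_zero_cons]; simp

lemma isCat_replicate (m : ℕ) : IsCat (List.replicate m 0) := by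
  refine ⟨(slow_one_replicate m).tail, ?_⟩
  intro k l₁ l₂ h
  have : k + 1 ∈ List.replicate m 0 := by rw [h]; simp
  simp [List.mem_replicate] at this

lemma letterSum_succ (x v w : ℝ≥0∞) (i : ℕ) :
    letterSum x v (i + 1) w + x * w * (1 - x * w)⁻¹ * letterSum x v i 1 =
      x * w * (1 - x * w)⁻¹ * letterSum x v i (1 - x * w)⁻¹ := by
  have := tsum_isCat_peel (x * w)
    (fun b => if i ∈ b then x ^ b.length * v ^ b.count i else 0)
  unfold letterSum
  simp only [one_pow, one_mul]
  rw [← this]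
  congr 2; ext a
  by_cases hi : i + 1 ∈ a
  · have h1 : peel a ≠ [] := List.ne_nil_of_mem (mem_peel.2 hi)
    have h2 : a ≠ [] := List.ne_nil_of_mem hi
    simp only [h1, h2, hi, mem_peel, count_peel, ne_eq, not_false_eq_true, and_true, if_true,
      length_eq_count_add_length_peel a]
    congr 1; ring
  · simp [hi]

lemma tsum_isCat_peel_eq_nil (y : ℝ≥0∞) :
    ∑' a, (if IsCat a ∧ a ≠ [] ∧ peel a = [] then y ^ a.count 0 else 0) =
      y * (1 - y)⁻¹ := by
  have hinj : Function.Injective (fun m : ℕ => List.replicate (m + 1) 0) :=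
    fun m m' h => by simpa using congrArg List.length h
  rw [← hinj.tsum_eq]
  · have e : ∀ m : ℕ, List.replicate (m + 1) 0 ≠ [] := by simp
    simp only [isCat_replicate, peel_replicate_zero, e, ne_eq, not_false_eq_true, and_self,
      if_true, List.count_replicate_self, pow_succ', ENNReal.tsum_mul_left,
      ENNReal.tsum_geometric]
  · intro a ha
    simp only [Function.mem_support, ne_eq, ite_eq_right_iff, not_forall] at ha
    obtain ⟨m, rfl⟩ := exists_eq_of_peel_eq_nil ha.1.2.2
    cases m with
    | zero => simp at ha
    | succ m => exact ⟨m, rfl⟩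

lemma depthSum_zero (x w : ℝ≥0∞) : depthSum x 0 w = 0 := by
  unfold depthSum
  rw [ENNReal.tsum_eq_zero]
  rintro (_ | ⟨c, a⟩)
  · simp
  · rw [if_neg (c := ∀ c' ∈ c :: a, (c' : ℕ∞) < 0) fun h => absurd (h c (by simp)) not_lt_zero]
    simp

lemma depthSum_succ (x w : ℝ≥0∞) (d : ℕ∞) :
    depthSum x (d + 1) w + x * w * (1 - x * w)⁻¹ * depthSum x d 1 =
      x * w * (1 - x * w)⁻¹ * (1 + depthSum x d (1 - x * w)⁻¹) := by
  have := tsum_isCat_peel (x * w) (fun b => if ∀ c ∈ b, (c : ℕ∞) < d then x ^ b.length else 0)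
  rw [mul_add, mul_one]
  nth_rw 2 [← tsum_isCat_peel_eq_nil]
  unfold depthSum
  simp only [one_pow, one_mul]
  rw [← this, ← add_assoc, ← ENNReal.tsum_add]
  congr 2; ext a
  by_cases hc : IsCat a
  · by_cases hp : peel a = []
    · obtain ⟨m, rfl⟩ := exists_eq_of_peel_eq_nil hp
      cases m with
      | zero => simp
      | succ m =>
        have : ∀ c ∈ List.replicate (m + 1) (0 : ℕ), (c : ℕ∞) < d + 1 := by
          simp [List.mem_replicate]
        have e : List.replicate (m + 1) 0 ≠ [] := by simp
        rw [if_pos this]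
        simp only [hc, hp, e, ne_eq, not_true, not_false_eq_true, and_true, and_false,
          if_true, if_false, add_zero, mul_pow, List.length_replicate,
          List.count_replicate_self]
        ring
    · have h2 : a ≠ [] := by rintro rfl; simp at hp
      have e : (∀ c ∈ a, (c : ℕ∞) < d + 1) ↔ ∀ c ∈ peel a, (c : ℕ∞) < d := by
        simp only [mem_peel]
        constructor
        · intro h c hc
          simpa [ENat.add_lt_add_iff_right ENat.one_ne_top] using h _ hc
        · intro h c hc
          cases c with
          | zero => simp
          | succ c => simpa [ENat.add_lt_add_iff_right ENat.one_ne_top] using h c hc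
      simp only [hc, hp, h2, e, ne_eq, not_false_eq_true, and_true, and_false, if_true,
        if_false, zero_add]
      rw [length_eq_count_add_length_peel a]
      split_ifs <;> ring
  · simp [hc]

lemma letterSum_zero (x v w : ℝ≥0∞) : letterSum x v 0 w = letterSum x 1 0 (v * w) := by
  unfold letterSum
  congr 1; ext a
  split_ifs <;> ring

lemma letterSum_le (x v w : ℝ≥0∞) (hv : v ≤ 1) (i : ℕ) :
    letterSum x v i w ≤ letterSum x 1 0 w := by
  refine ENNReal.tsum_le_tsum fun a => ?_
  by_cases h : IsCat a ∧ a ≠ []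
  · rw [if_pos h, if_pos h, if_pos (zero_mem_of_isCat h.1 h.2), one_pow]
    gcongr
    split_ifs
    · gcongr
      exact pow_le_one' hv _
    · exact zero_le
  · rw [if_neg h, if_neg h]

lemma depthSum_top_eq_letterSum (x w : ℝ≥0∞) : depthSum x ⊤ w = letterSum x 1 0 w := by
  unfold depthSum letterSum
  congr 1; ext a
  by_cases h : IsCat a ∧ a ≠ []
  · rw [if_pos h, if_pos h, if_pos (zero_mem_of_isCat h.1 h.2)]
    simp
  · rw [if_neg h, if_neg h]

lemma depthSum_top_le {x w B : ℝ≥0∞} (h : ∀ d : ℕ, depthSum x d w ≤ B) :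
    depthSum x ⊤ w ≤ B := by
  refine ENNReal.summable.tsum_le_of_sum_le fun s => ?_
  refine le_trans ?_ ((ENNReal.sum_le_tsum s).trans (h (s.sup List.sum + 1)))
  refine Finset.sum_le_sum fun a ha => ?_
  have hd : ∀ c ∈ a, (c : ℕ∞) < ((s.sup List.sum + 1 : ℕ) : ℕ∞) := fun c hc =>
    Nat.cast_lt.2 <| Nat.lt_succ_of_le
      ((List.le_sum_of_mem hc).trans (Finset.le_sup (f := List.sum) ha))
  rw [if_pos hd]
  split_ifs <;> simp

lemma countEq_eq_count {n : ℕ} (a : Fin n → ℕ) (c : ℕ) :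
    countEq a c = (List.ofFn a).count c := by
  rw [← Multiset.coe_count, ← Fin.univ_val_map, Multiset.count_map, countEq,
    Set.ncard_eq_toFinset_card']
  simp [Finset.card, eq_comm]

lemma isCatalanWord_iff {n : ℕ} (a : Fin n → ℕ) :
    IsCatalanWord a ↔ IsCat (List.ofFn a) := by
  unfold IsCatalanWord IsCat Slow
  rw [List.isChain_iff_getElem]
  apply and_congr
  · simp
  · constructor
    · intro h k l₁ l₂ hl hk
      have hlen : n = l₁.length + (l₂.length + 1) := by
        simpa using congrArg List.length hl
      have hget : ∀ (j : ℕ) (hj : j < n), a ⟨j, hj⟩ = (l₁ ++ (k + 1) :: l₂)[j]'(by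
          simpa [← hlen] using hj) := by
        intro j hj
        simp [← hl]
      obtain ⟨⟨i₁, h₁, e₁⟩, ⟨i₂, h₂, e₂⟩⟩ := h ⟨l₁.length, by omega⟩ (by rw [hget]; simp) (by
        intro j hj
        by_contra hlt
        rw [Fin.le_def, not_le] at hlt
        simp only at hlt
        rw [hget l₁.length, ← Fin.eta j j.2, hget j, List.getElem_append_left hlt] at hj
        apply hk
        simp only [List.getElem_append_right le_rfl, Nat.sub_self, List.getElem_cons_zero] at hj
        rw [← hj]
        exact List.getElem_mem _)
      rw [Fin.lt_def] at h₁ h₂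
      simp only at h₁ h₂
      rw [hget l₁.length, ← Fin.eta i₁ i₁.2, hget i₁, List.getElem_append_left h₁] at e₁
      rw [hget l₁.length, ← Fin.eta i₂ i₂.2, hget i₂, List.getElem_append_right h₂.le] at e₂
      simp only [List.getElem_append_right le_rfl, Nat.sub_self, List.getElem_cons_zero,
        Nat.add_right_cancel_iff] at e₁ e₂
      obtain ⟨r, hr⟩ : ∃ r, i₂.1 - l₁.length = r + 1 := ⟨i₂.1 - l₁.length - 1, by omega⟩
      simp only [hr, List.getElem_cons_succ] at e₂
      exact ⟨e₁ ▸ List.getElem_mem _, e₂ ▸ List.getElem_mem _⟩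
    · intro h i hi hmin
      obtain ⟨k, hk⟩ := Nat.exists_eq_succ_of_ne_zero hi.ne'
      have hi' : i.1 < (List.ofFn a).length := by simp
      have hg : (List.ofFn a)[i.1] = k + 1 := by simpa using hk
      have := h k ((List.ofFn a).take i) ((List.ofFn a).drop (i + 1)) (by
        rw [← hg, List.getElem_cons_drop, List.take_append_drop]) (by
        intro hmem
        obtain ⟨j, hj, e⟩ := List.mem_take_iff_getElem.1 hmem
        have hj' : j < i.1 ∧ j < n := by
          have : j < i.1 := by simpa using hj
          exact ⟨this, this.trans i.2⟩
        have := hmin ⟨j, hj'.2⟩ (by rw [hk]; simpa using e)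
        rw [Fin.le_def] at this
        simp only at this
        omega)
      obtain ⟨h₁, h₂⟩ := this
      obtain ⟨j, hj, e⟩ := List.mem_take_iff_getElem.1 h₁
      obtain ⟨j', hj', e'⟩ := List.mem_drop_iff_getElem.1 h₂
      have hj : j < i.1 ∧ j < n := by
        have : j < i.1 := by simpa using hj
        exact ⟨this, this.trans i.2⟩
      simp only [List.length_ofFn] at hj'
      refine ⟨⟨⟨j, hj.2⟩, Fin.lt_def.2 hj.1, ?_⟩, ⟨⟨i + 1 + j', by omega⟩, Fin.lt_def.2 ?_, ?_⟩⟩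
      · rw [hk]; simpa using e
      · simp only; omega
      · rw [hk]; simpa using e'

lemma finite_isCatalanWord {x : ℝ≥0∞} (hx : x ≠ 0) (hfin : letterSum x 1 0 1 ≠ ⊤) (n : ℕ) :
    {a : Fin n → ℕ | IsCatalanWord a}.Finite := by
  rcases Nat.eq_zero_or_pos n with rfl | hn
  · exact Set.toFinite _
  refine ((ENNReal.finite_const_le_of_tsum_ne_top hfin (pow_ne_zero n hx)).preimage
    (List.ofFn_injective (n := n)).injOn).subset fun a ha => ?_
  have hc := (isCatalanWord_iff a).1 ha
  have hne : List.ofFn a ≠ [] := by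
    rw [← List.length_pos_iff]; simpa using hn
  change x ^ n ≤ if _ then _ else _
  rw [if_pos ⟨hc, hne⟩, if_pos (zero_mem_of_isCat hc hne)]
  simp

lemma tsum_numLet (x w v : ℝ≥0∞) (i : ℕ)
    (hfin : ∀ n, {a : Fin n → ℕ | IsCatalanWord a}.Finite) :
    ∑' (s : ℕ) (t : ℕ) (n : ℕ), (numLet i n (s + 1) (t + 1) : ℝ≥0∞) * x ^ n * w ^ (t + 1) *
      v ^ (s + 1) = letterSum x v i w := by
  have e : ∀ n s t, (numLet i n s t : ℝ≥0∞) = ∑' a : Fin n → ℕ,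
      if IsCatalanWord a ∧ countEq a i = s ∧ countEq a 0 = t then 1 else 0 := by
    intro n s t
    have hf : {a : Fin n → ℕ | IsCatalanWord a ∧ countEq a i = s ∧ countEq a 0 = t}.Finite :=
      (hfin n).subset fun a h => h.1
    have := ENNReal.tsum_set_const
      {a : Fin n → ℕ | IsCatalanWord a ∧ countEq a i = s ∧ countEq a 0 = t} 1
    rw [tsum_subtype _ (fun _ => (1 : ℝ≥0∞)), mul_one, ← hf.cast_ncard_eq] at this
    simp only [Set.indicator_apply, Set.mem_ofPred_eq] at this
    rw [this]
    simp [numLet]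
  have e2 : letterSum x v i w = ∑' (n : ℕ) (a : Fin n → ℕ),
      if IsCatalanWord a ∧ List.ofFn a ≠ [] then (w ^ countEq a 0 *
        if i ∈ List.ofFn a then x ^ n * v ^ countEq a i else 0) else 0 := by
    unfold letterSum
    rw [← (List.equivSigmaTuple (α := ℕ)).symm.tsum_eq, ENNReal.tsum_sigma']
    simp only [isCatalanWord_iff, countEq_eq_count, List.equivSigmaTuple,
      Equiv.coe_fn_symm_mk, List.length_ofFn]
  rw [e2]
  calc _ = ∑' (s : ℕ) (n : ℕ) (a : Fin n → ℕ) (t : ℕ),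
        (if IsCatalanWord a ∧ countEq a i = s + 1 ∧ countEq a 0 = t + 1 then 1 else 0) *
          (x ^ n * w ^ (t + 1) * v ^ (s + 1)) := by
        congr 1; ext s
        rw [ENNReal.tsum_comm]
        congr 1; ext n
        rw [ENNReal.tsum_comm]
        congr 1; ext t
        rw [e, ENNReal.tsum_mul_right, mul_assoc, mul_assoc, mul_assoc]
    _ = ∑' (n : ℕ) (a : Fin n → ℕ) (s : ℕ) (t : ℕ),
        (if IsCatalanWord a ∧ countEq a i = s + 1 ∧ countEq a 0 = t + 1 then 1 else 0) *
          (x ^ n * w ^ (t + 1) * v ^ (s + 1)) := by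
        rw [ENNReal.tsum_comm]
        congr 1; ext n
        rw [ENNReal.tsum_comm]
    _ = _ := by
        congr 1; ext n
        congr 1; ext a
        by_cases h : (IsCatalanWord a ∧ List.ofFn a ≠ []) ∧ i ∈ List.ofFn a
        · have h0 := zero_mem_of_isCat ((isCatalanWord_iff a).1 h.1.1) h.1.2
          have hi := h.2
          rw [← List.count_pos_iff, ← countEq_eq_count] at h0 hi
          obtain ⟨s, hs⟩ := Nat.exists_eq_succ_of_ne_zero hi.ne'
          obtain ⟨t, ht⟩ := Nat.exists_eq_succ_of_ne_zero h0.ne'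
          rw [if_pos h.1, if_pos h.2, hs, ht, tsum_eq_single s, tsum_eq_single t]
          · simp [h.1.1]; ring
          · intro t' ht'; simp [Ne.symm ht']
          · intro s' hs'; simp [Ne.symm hs']
        · have : ∀ s t, ¬ (IsCatalanWord a ∧ countEq a i = s + 1 ∧ countEq a 0 = t + 1) := by
            rintro s t ⟨h1, h2, -⟩
            have : i ∈ List.ofFn a := by
              rw [← List.count_pos_iff, ← countEq_eq_count]; omega
            exact h ⟨⟨h1, List.ne_nil_of_mem this⟩, this⟩
          simp only [this, if_false, zero_mul, tsum_zero]
          split_ifs <;> simp_all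

lemma Cfun_spec {x : ℝ} (hx0 : 0 < x) (hx : x < 1 / 4) :
    x * Cfun x ^ 2 = Cfun x - 1 ∧ 1 < Cfun x ∧ Cfun x < 2 := by
  have hs : 0 < Real.sqrt (1 - 4 * x) := Real.sqrt_pos.2 (by linarith)
  have hs2 : Real.sqrt (1 - 4 * x) ^ 2 = 1 - 4 * x := Real.sq_sqrt (by linarith)
  unfold Cfun
  generalize Real.sqrt (1 - 4 * x) = s at hs hs2
  refine ⟨?_, ?_, ?_⟩
  · field_simp; nlinarith
  · rw [lt_div_iff₀ (by linarith)]; nlinarith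
  · rw [div_lt_iff₀ (by linarith)]; nlinarith

/-- The map `w ↦ 1 / (1 - x w)` whose iterates are the functions `Lfun`. -/
noncomputable def step (x w : ℝ) : ℝ := 1 / (1 - x * w)

section
variable {x w : ℝ} (hx0 : 0 < x) (hx : x < 1 / 4)
include hx0 hx

lemma one_sub_mul_Cfun : (1 - x * Cfun x) * Cfun x = 1 := by
  linarith [(Cfun_spec hx0 hx).1]

lemma one_sub_mul_pos (hw : w ≤ Cfun x) : 0 < 1 - x * w := by
  obtain ⟨-, h1, h2⟩ := Cfun_spec hx0 hx
  nlinarith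

lemma step_Cfun : step x (Cfun x) = Cfun x := by
  rw [step, div_eq_iff (one_sub_mul_pos hx0 hx le_rfl).ne', mul_comm, one_sub_mul_Cfun hx0 hx]

lemma step_le_step {w' : ℝ} (h : w ≤ w') (hw' : w' ≤ Cfun x) : step x w ≤ step x w' := by
  have := one_sub_mul_pos hx0 hx hw'
  unfold step
  gcongr

lemma step_mem (hw0 : 0 ≤ w) (hw : w ≤ Cfun x) : 1 ≤ step x w ∧ step x w ≤ Cfun x := by
  constructor
  · rw [step, le_div_iff₀ (one_sub_mul_pos hx0 hx hw)]; nlinarith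
  · exact (step_le_step hx0 hx hw le_rfl).trans_eq (step_Cfun hx0 hx)

lemma Afun_eq (hw : w ≤ Cfun x) :
    Afun x w = x * w * step x w * (1 + Afun x (step x w) - Afun x 1) := by
  obtain ⟨h1, h2, h3⟩ := Cfun_spec hx0 hx
  have hC := one_sub_mul_Cfun hx0 hx
  have hp := one_sub_mul_pos hx0 hx hw
  have hp' : 0 < 1 - x * w * Cfun x := by nlinarith
  have hp1 : 0 < 1 - x * Cfun x := one_sub_mul_pos hx0 hx le_rfl
  have e1 : Afun x 1 = x * Cfun x := by
    unfold Afun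
    rw [div_eq_iff (by linarith)]
    linear_combination -x * hC
  have e2 : Afun x (step x w) = x * Cfun x / (1 - x * w * Cfun x) := by
    have h4 : 1 - x * step x w * Cfun x =
        (1 - x * w * Cfun x) / Cfun x * step x w := by
      unfold step
      field_simp
      linear_combination (-1 : ℝ) * h1
    have h5 : 0 < step x w := by unfold step; positivity
    unfold Afun
    rw [h4]
    field_simp
  rw [e1, e2]
  unfold Afun step
  field_simp
  linear_combination (-w ^ 2 * x) * h1

lemma Afun_mono {w' : ℝ} (hw0 : 0 ≤ w) (h : w ≤ w') (hw' : w' ≤ Cfun x) :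
    Afun x w ≤ Afun x w' := by
  obtain ⟨h1, h2, h3⟩ := Cfun_spec hx0 hx
  have hp' : 0 < 1 - x * w' * Cfun x := by nlinarith
  have : 0 ≤ w' := hw0.trans h
  unfold Afun
  gcongr

lemma ofReal_step (hw0 : 0 ≤ w) (hw : w ≤ Cfun x) :
    (1 - ENNReal.ofReal x * ENNReal.ofReal w)⁻¹ = ENNReal.ofReal (step x w) := by
  have hp := one_sub_mul_pos hx0 hx hw
  rw [← ENNReal.ofReal_mul hx0.le, ← ENNReal.ofReal_one,
    ← ENNReal.ofReal_sub _ (by positivity), ← ENNReal.ofReal_inv_of_pos hp, step, one_div]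

lemma toReal_eq_of_add_eq {X Y Z : ℝ≥0∞} (hw0 : 0 ≤ w) (hw : w ≤ Cfun x)
    (hY : Y ≠ ⊤) (hZ : Z ≠ ⊤)
    (h : X + ENNReal.ofReal x * ENNReal.ofReal w *
        (1 - ENNReal.ofReal x * ENNReal.ofReal w)⁻¹ * Y =
      ENNReal.ofReal x * ENNReal.ofReal w *
        (1 - ENNReal.ofReal x * ENNReal.ofReal w)⁻¹ * Z) :
    X ≠ ⊤ ∧ X.toReal = x * w * step x w * (Z.toReal - Y.toReal) := by
  have hs : 0 ≤ step x w := by linarith [(step_mem hx0 hx hw0 hw).1]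
  rw [ofReal_step hx0 hx hw0 hw, ← ENNReal.ofReal_mul hx0.le,
    ← ENNReal.ofReal_mul (by positivity)] at h
  have hX : X ≠ ⊤ := by
    refine ne_top_of_le_ne_top ?_ (le_self_add.trans h.le)
    exact ENNReal.mul_ne_top ENNReal.ofReal_ne_top hZ
  refine ⟨hX, ?_⟩
  have := congrArg ENNReal.toReal h
  rw [ENNReal.toReal_add hX (ENNReal.mul_ne_top ENNReal.ofReal_ne_top hY),
    ENNReal.toReal_mul, ENNReal.toReal_mul, ENNReal.toReal_ofReal (by positivity)] at this
  linear_combination this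

lemma depthSum_add_one {d : ℕ∞} (hd : ∀ u, 0 ≤ u → u ≤ Cfun x →
      depthSum (ENNReal.ofReal x) d (ENNReal.ofReal u) ≠ ⊤)
    (hw0 : 0 ≤ w) (hw : w ≤ Cfun x) :
    depthSum (ENNReal.ofReal x) (d + 1) (ENNReal.ofReal w) ≠ ⊤ ∧
    (depthSum (ENNReal.ofReal x) (d + 1) (ENNReal.ofReal w)).toReal = x * w * step x w *
      (1 + (depthSum (ENNReal.ofReal x) d (ENNReal.ofReal (step x w))).toReal -
        (depthSum (ENNReal.ofReal x) d (ENNReal.ofReal 1)).toReal) := by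
  obtain ⟨hs1, hs2⟩ := step_mem hx0 hx hw0 hw
  have h1 := hd 1 zero_le_one (hs1.trans hs2)
  have h2 := hd (step x w) (by linarith) hs2
  have h := depthSum_succ (ENNReal.ofReal x) (ENNReal.ofReal w) d
  rw [ENNReal.ofReal_one] at h1 ⊢
  have := toReal_eq_of_add_eq hx0 hx hw0 hw h1 (by rw [ofReal_step hx0 hx hw0 hw]; finiteness) h
  rwa [ofReal_step hx0 hx hw0 hw, ENNReal.toReal_add (by finiteness) h2,
    ENNReal.toReal_one] at this

lemma depthSum_natCast_ne_top (d : ℕ) (hw0 : 0 ≤ w) (hw : w ≤ Cfun x) :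
    depthSum (ENNReal.ofReal x) d (ENNReal.ofReal w) ≠ ⊤ := by
  induction d generalizing w with
  | zero => simp [depthSum_zero]
  | succ d ih =>
    exact_mod_cast (depthSum_add_one hx0 hx (fun u h0 h => ih h0 h) hw0 hw).1

lemma depthSum_sub_le (d : ℕ) {w' : ℝ} (hw0 : 0 ≤ w) (h : w ≤ w') (hw' : w' ≤ Cfun x) :
    (depthSum (ENNReal.ofReal x) d (ENNReal.ofReal w')).toReal -
      (depthSum (ENNReal.ofReal x) d (ENNReal.ofReal w)).toReal ≤ Afun x w' - Afun x w := by
  induction d generalizing w w' with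
  | zero => simpa [depthSum_zero] using Afun_mono hx0 hx hw0 h hw'
  | succ d ih =>
    have hn := fun u h0 h => depthSum_natCast_ne_top (w := u) hx0 hx d h0 h
    obtain ⟨hs1, hs2⟩ := step_mem hx0 hx hw0 (h.trans hw')
    obtain ⟨hs1', hs2'⟩ := step_mem hx0 hx (hw0.trans h) hw'
    have hss := step_le_step hx0 hx h hw'
    rw [Nat.cast_add, Nat.cast_one, (depthSum_add_one hx0 hx hn hw0 (h.trans hw')).2,
      (depthSum_add_one hx0 hx hn (hw0.trans h) hw').2, Afun_eq hx0 hx hw',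
      Afun_eq hx0 hx (h.trans hw')]
    have i1 := ih zero_le_one hs1' hs2'
    have i2 := ih (by linarith) hss hs2'
    have r0 : 0 ≤ x * w * step x w := by positivity
    have r1 : x * w * step x w ≤ x * w' * step x w' := by
      have : 0 ≤ w' := hw0.trans h
      gcongr
    nlinarith [mul_le_mul_of_nonneg_left i1 (sub_nonneg.2 r1), mul_le_mul_of_nonneg_left i2 r0]

lemma depthSum_top_le_add {w' : ℝ} (hw0 : 0 ≤ w) (h : w ≤ w') (hw' : w' ≤ Cfun x) :
    depthSum (ENNReal.ofReal x) ⊤ (ENNReal.ofReal w') ≤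
      depthSum (ENNReal.ofReal x) ⊤ (ENNReal.ofReal w) +
        ENNReal.ofReal (Afun x w' - Afun x w) := by
  refine depthSum_top_le fun d => ?_
  have h1 := depthSum_sub_le hx0 hx d hw0 h hw'
  have h2 := depthSum_natCast_ne_top hx0 hx d hw0 (h.trans hw')
  have h3 := depthSum_natCast_ne_top hx0 hx d (hw0.trans h) hw'
  have hle : depthSum (ENNReal.ofReal x) d (ENNReal.ofReal w) ≤
      depthSum (ENNReal.ofReal x) ⊤ (ENNReal.ofReal w) := by
    refine ENNReal.tsum_le_tsum fun a => ?_
    split_ifs <;> simp_all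
  refine le_trans ?_ (add_le_add_left hle _)
  rw [← ENNReal.ofReal_toReal h2, ← ENNReal.ofReal_toReal h3,
    ← ENNReal.ofReal_add (by positivity) (sub_nonneg.2 (Afun_mono hx0 hx hw0 h hw'))]
  exact ENNReal.ofReal_le_ofReal (by linarith)

lemma depthSum_top (hw0 : 0 ≤ w) (hw : w ≤ Cfun x) :
    depthSum (ENNReal.ofReal x) ⊤ (ENNReal.ofReal w) = ENNReal.ofReal (Afun x w) := by
  obtain ⟨h1, h2, h3⟩ := Cfun_spec hx0 hx
  have h0 : depthSum (ENNReal.ofReal x) ⊤ (ENNReal.ofReal 0) = 0 := by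
    unfold depthSum
    rw [ENNReal.tsum_eq_zero]
    intro a
    by_cases h : IsCat a ∧ a ≠ []
    · have := List.count_pos_iff.2 (zero_mem_of_isCat h.1 h.2)
      simp [this.ne']
    · rw [if_neg h]
  have hA0 : Afun x 0 = 0 := by simp [Afun]
  have hle : ∀ u, 0 ≤ u → u ≤ Cfun x → depthSum (ENNReal.ofReal x) ⊤ (ENNReal.ofReal u) ≤
      ENNReal.ofReal (Afun x u) := by
    intro u hu0 hu
    simpa [h0, hA0, -ENNReal.ofReal_zero] using depthSum_top_le_add hx0 hx le_rfl hu0 hu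
  have hfin : ∀ u, 0 ≤ u → u ≤ Cfun x →
      depthSum (ENNReal.ofReal x) ⊤ (ENNReal.ofReal u) ≠ ⊤ := fun u hu0 hu =>
    ne_top_of_le_ne_top ENNReal.ofReal_ne_top (hle u hu0 hu)
  have hApos : ∀ u, 0 ≤ u → u ≤ Cfun x → 0 ≤ Afun x u := fun u hu0 hu =>
    hA0 ▸ Afun_mono hx0 hx le_rfl hu0 hu
  have hleR : ∀ u, 0 ≤ u → u ≤ Cfun x →
      (depthSum (ENNReal.ofReal x) ⊤ (ENNReal.ofReal u)).toReal ≤ Afun x u := fun u hu0 hu =>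
    ENNReal.toReal_le_of_le_ofReal (hApos u hu0 hu) (hle u hu0 hu)
  have hC0 : 0 ≤ Cfun x := by linarith
  have hrec := (depthSum_add_one hx0 hx hfin hC0 le_rfl).2
  rw [top_add, step_Cfun hx0 hx] at hrec
  have hA := Afun_eq hx0 hx (le_refl (Cfun x))
  rw [step_Cfun hx0 hx] at hA
  have he1 := hleR 1 zero_le_one h2.le
  have hd := depthSum_top_le_add hx0 hx hw0 hw le_rfl
  rw [← ENNReal.toReal_le_toReal (hfin _ hC0 le_rfl)
    (ENNReal.add_ne_top.2 ⟨hfin w hw0 hw, ENNReal.ofReal_ne_top⟩),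
    ENNReal.toReal_add (hfin w hw0 hw) ENNReal.ofReal_ne_top,
    ENNReal.toReal_ofReal (sub_nonneg.2 (Afun_mono hx0 hx hw0 hw le_rfl))] at hd
  rw [← ENNReal.ofReal_toReal (hfin w hw0 hw)]
  congr 1
  refine le_antisymm (hleR w hw0 hw) ?_
  have hxC : x * Cfun x * Cfun x = Cfun x - 1 := by linarith
  rw [hxC] at hrec hA
  generalize (depthSum (ENNReal.ofReal x) ⊤ (ENNReal.ofReal (Cfun x))).toReal = WC at *
  generalize (depthSum (ENNReal.ofReal x) ⊤ (ENNReal.ofReal 1)).toReal = W1 at *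
  have : (2 - Cfun x) * (Afun x (Cfun x) - WC) = -((Cfun x - 1) * (Afun x 1 - W1)) := by
    linear_combination hA - hrec
  have : (2 - Cfun x) * (Afun x (Cfun x) - WC) ≤ 0 := by
    rw [this]
    have := mul_nonneg (sub_nonneg.2 h2.le) (sub_nonneg.2 he1)
    linarith
  have : Afun x (Cfun x) - WC ≤ 0 := by
    by_contra hc
    push Not at hc
    have := mul_pos (sub_pos.2 h3) hc
    linarith
  linarith

end

section
variable {x v w : ℝ} (hx0 : 0 < x) (hx : x < 1 / 4)
include hx0 hx

lemma letterSum_le_ofReal (hv : v ≤ 1) (hw0 : 0 ≤ w) (hw : w ≤ Cfun x) (i : ℕ) :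
    letterSum (ENNReal.ofReal x) (ENNReal.ofReal v) i (ENNReal.ofReal w) ≤
      ENNReal.ofReal (Afun x (Cfun x)) := by
  refine (letterSum_le _ _ _ (by simpa using hv) i).trans ?_
  rw [← depthSum_top_eq_letterSum, depthSum_top hx0 hx hw0 hw]
  exact ENNReal.ofReal_le_ofReal (Afun_mono hx0 hx hw0 hw le_rfl)

lemma toReal_letterSum_succ (hv : v ≤ 1) (hw0 : 0 ≤ w) (hw : w ≤ Cfun x) (i : ℕ) :
    (letterSum (ENNReal.ofReal x) (ENNReal.ofReal v) (i + 1) (ENNReal.ofReal w)).toReal =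
      x * w * step x w *
      ((letterSum (ENNReal.ofReal x) (ENNReal.ofReal v) i (ENNReal.ofReal (step x w))).toReal -
      (letterSum (ENNReal.ofReal x) (ENNReal.ofReal v) i (ENNReal.ofReal 1)).toReal) := by
  obtain ⟨hs1, hs2⟩ := step_mem hx0 hx hw0 hw
  have hfin : ∀ u, 0 ≤ u → u ≤ Cfun x →
      letterSum (ENNReal.ofReal x) (ENNReal.ofReal v) i (ENNReal.ofReal u) ≠ ⊤ :=
    fun u h0 h => ne_top_of_le_ne_top ENNReal.ofReal_ne_top (letterSum_le_ofReal hx0 hx hv h0 h i)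
  have h := letterSum_succ (ENNReal.ofReal x) (ENNReal.ofReal v) (ENNReal.ofReal w) i
  have h1 := hfin 1 zero_le_one (hs1.trans hs2)
  rw [ENNReal.ofReal_one] at h1 ⊢
  have := (toReal_eq_of_add_eq hx0 hx hw0 hw h1
    (by rw [ofReal_step hx0 hx hw0 hw]; exact hfin _ (by linarith) hs2) h).2
  rwa [ofReal_step hx0 hx hw0 hw] at this

lemma toReal_letterSum_zero (hv0 : 0 ≤ v) (hv : v ≤ 1) (hw0 : 0 ≤ w) (hw : w ≤ Cfun x) :
    (letterSum (ENNReal.ofReal x) (ENNReal.ofReal v) 0 (ENNReal.ofReal w)).toReal =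
      Afun x (v * w) := by
  have h0 : 0 ≤ v * w := by positivity
  have h1 : v * w ≤ Cfun x := by nlinarith
  rw [letterSum_zero, ← ENNReal.ofReal_mul hv0, ← depthSum_top_eq_letterSum,
    depthSum_top hx0 hx h0 h1, ENNReal.toReal_ofReal]
  have := Afun_mono hx0 hx le_rfl h0 h1
  simpa [Afun] using this

end

/-- Real generating function of Catalan words by zeros, a marked letter, and its value. -/
noncomputable def markedSum (x v q w : ℝ) : ℝ :=
  ∑' i : ℕ, q ^ (i + 1) *
    (letterSum (ENNReal.ofReal x) (ENNReal.ofReal v) (i + 1) (ENNReal.ofReal w)).toReal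

section
variable {x v q w : ℝ} (hx0 : 0 < x) (hx : x < 1 / 4) (hv0 : 0 ≤ v) (hv : v ≤ 1)
  (hq0 : 0 < q) (hq : q < 1)
include hx0 hx hv

lemma toReal_letterSum_le (hw0 : 0 ≤ w) (hw : w ≤ Cfun x) (i : ℕ) :
    (letterSum (ENNReal.ofReal x) (ENNReal.ofReal v) i (ENNReal.ofReal w)).toReal ≤
      Afun x (Cfun x) := by
  refine ENNReal.toReal_le_of_le_ofReal ?_ (letterSum_le_ofReal hx0 hx hv hw0 hw i)
  have := Afun_mono hx0 hx le_rfl (hw0.trans hw) le_rfl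
  simpa [Afun] using this

include hq0 hq

lemma summable_letterSum (hw0 : 0 ≤ w) (hw : w ≤ Cfun x) : Summable fun i : ℕ => q ^ i *
    (letterSum (ENNReal.ofReal x) (ENNReal.ofReal v) i (ENNReal.ofReal w)).toReal := by
  refine Summable.of_nonneg_of_le (fun i => by positivity) (fun i => ?_)
    ((summable_geometric_of_lt_one hq0.le hq).mul_right (Afun x (Cfun x)))
  exact mul_le_mul_of_nonneg_left (toReal_letterSum_le hx0 hx hv hw0 hw i) (by positivity)

lemma markedSum_mem (hw0 : 0 ≤ w) (hw : w ≤ Cfun x) :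
    0 ≤ markedSum x v q w ∧ markedSum x v q w ≤ Afun x (Cfun x) * (1 - q)⁻¹ := by
  constructor
  · exact tsum_nonneg fun i => by positivity
  · have hs := summable_letterSum hx0 hx hv hq0 hq hw0 hw
    have hg := (summable_geometric_of_lt_one hq0.le hq).mul_right (Afun x (Cfun x))
    rw [mul_comm, ← tsum_geometric_of_lt_one hq0.le hq, ← tsum_mul_right]
    refine le_trans ?_ (hs.tsum_le_tsum (fun i => mul_le_mul_of_nonneg_left
      (toReal_letterSum_le hx0 hx hv hw0 hw i) (by positivity)) hg)
    rw [hs.tsum_eq_zero_add, markedSum]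
    exact le_add_of_nonneg_left (by positivity)

include hv0

lemma markedSum_eq (hw0 : 0 ≤ w) (hw : w ≤ Cfun x) :
    markedSum x v q w = q * (x * w * step x w) * (Afun x (v * step x w) - Afun x v -
      markedSum x v q 1 + markedSum x v q (step x w)) := by
  obtain ⟨hs1, hs2⟩ := step_mem hx0 hx hw0 hw
  have hs0 : 0 ≤ step x w := by linarith
  have h1C := hs1.trans hs2
  have hS := summable_letterSum hx0 hx hv hq0 hq hs0 hs2
  have h1 := summable_letterSum hx0 hx hv hq0 hq zero_le_one h1C
  have eS := hS.tsum_eq_zero_add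
  have e1 := h1.tsum_eq_zero_add
  rw [toReal_letterSum_zero hx0 hx hv0 hv hs0 hs2] at eS
  rw [toReal_letterSum_zero hx0 hx hv0 hv zero_le_one h1C] at e1
  have e : markedSum x v q w = q * (x * w * step x w) * ((∑' i : ℕ, q ^ i *
      (letterSum (ENNReal.ofReal x) (ENNReal.ofReal v) i (ENNReal.ofReal (step x w))).toReal) -
      ∑' i : ℕ, q ^ i *
      (letterSum (ENNReal.ofReal x) (ENNReal.ofReal v) i (ENNReal.ofReal 1)).toReal) := by
    rw [← hS.tsum_sub h1, ← tsum_mul_left, markedSum]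
    congr 1; ext i
    rw [toReal_letterSum_succ hx0 hx hv hw0 hw]
    ring
  rw [e, eS, e1, markedSum, markedSum]
  simp only [pow_zero, one_mul, mul_one]
  ring

end

/-- Denominators arising from iterating `step`. -/
noncomputable def denom (x w : ℝ) (j : ℤ) : ℝ :=
  chebU j (1 / (2 * Real.sqrt x)) - w * Real.sqrt x * chebU (j - 1) (1 / (2 * Real.sqrt x))

lemma denom_zero (x w : ℝ) : denom x w 0 = 1 := by simp [denom, chebU]

lemma chebU_add_two (j : ℤ) (t : ℝ) : chebU (j + 2) t = 2 * t * chebU (j + 1) t - chebU j t := by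
  simp [chebU, Polynomial.Chebyshev.U_add_two]

section
variable {x w : ℝ} (hx0 : 0 < x)
include hx0

lemma sqrt_mul_chebU (j : ℤ) :
    Real.sqrt x * chebU (j + 2) (1 / (2 * Real.sqrt x)) =
      chebU (j + 1) (1 / (2 * Real.sqrt x)) -
        Real.sqrt x * chebU j (1 / (2 * Real.sqrt x)) := by
  have := Real.sqrt_pos.2 hx0
  rw [chebU_add_two]
  field_simp

lemma sqrt_mul_denom (j : ℤ) :
    Real.sqrt x * denom x w (j + 2) = denom x w (j + 1) - Real.sqrt x * denom x w j := by
  have h1 := sqrt_mul_chebU hx0 j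
  have h2 := sqrt_mul_chebU hx0 (j - 1)
  rw [show j - 1 + 2 = j + 1 by ring, show j - 1 + 1 = j by ring] at h2
  unfold denom
  rw [show j + 2 - 1 = j + 1 by ring, show j + 1 - 1 = j by ring]
  linear_combination h1 - w * Real.sqrt x * h2

lemma denom_one_eq (j : ℤ) :
    denom x 1 (j + 1) = Real.sqrt x * chebU (j + 2) (1 / (2 * Real.sqrt x)) := by
  rw [sqrt_mul_chebU hx0, denom, show j + 1 - 1 = j by ring, one_mul]

lemma sqrt_mul_denom_one : Real.sqrt x * denom x w 1 = 1 - x * w := by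
  have := Real.sqrt_pos.2 hx0
  have h2 := Real.sq_sqrt hx0.le
  simp only [denom, chebU, Polynomial.Chebyshev.U_one, sub_self, Polynomial.Chebyshev.U_zero]
  simp
  field_simp
  linear_combination -w * h2

end

section
variable {x w : ℝ} (hx0 : 0 < x) (hx : x < 1 / 4) (hw0 : 0 < w) (hw1 : w ≤ 1)
include hx0 hx hw0 hw1

lemma Lfun_mem (j : ℕ) : 1 ≤ Lfun x w j ∧ Lfun x w j ≤ Cfun x := by
  have hC := (Cfun_spec hx0 hx).2.1
  induction j with
  | zero => exact step_mem hx0 hx hw0.le (hw1.trans hC.le)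
  | succ j ih => exact step_mem hx0 hx (zero_le_one.trans ih.1) ih.2

lemma denom_pos_and_Lfun_eq (j : ℕ) : 0 < denom x w j ∧ 0 < denom x w (j + 1) ∧
    Lfun x w j = denom x w j / (Real.sqrt x * denom x w (j + 1)) := by
  have hC := (Cfun_spec hx0 hx).2.1
  have hs := Real.sqrt_pos.2 hx0
  have h2 := Real.mul_self_sqrt hx0.le
  induction j with
  | zero =>
    have h1 := one_sub_mul_pos hx0 hx (hw1.trans hC.le)
    have := sqrt_mul_denom_one (w := w) hx0
    simp only [Nat.cast_zero, zero_add, denom_zero, this]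
    exact ⟨one_pos, pos_of_mul_pos_right (this ▸ h1) hs.le, rfl⟩
  | succ j ih =>
    obtain ⟨h0, h1, hL⟩ := ih
    have hr := sqrt_mul_denom (w := w) hx0 j
    have hp := one_sub_mul_pos hx0 hx (Lfun_mem hx0 hx hw0 hw1 j).2
    have e : 1 - x * Lfun x w j = Real.sqrt x * denom x w (j + 2) / denom x w (j + 1) := by
      rw [hL, hr]
      field_simp
      linear_combination (denom x w j) * h2
    rw [e, lt_div_iff₀ h1, zero_mul] at hp
    push_cast
    rw [show (j : ℤ) + 1 + 1 = j + 2 by ring]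
    refine ⟨h1, pos_of_mul_pos_right hp hs.le, ?_⟩
    rw [Lfun, e, one_div_div]

end

/-- The sequence `w, L₀, L₁, …` of iterates of `step`. -/
noncomputable def orbit (x w : ℝ) : ℕ → ℝ
  | 0 => w
  | j + 1 => Lfun x w j

lemma step_orbit (x w : ℝ) (j : ℕ) : step x (orbit x w j) = Lfun x w j := by
  cases j <;> rfl

/-- The product of the multipliers collected along the first `n` iterations. -/
noncomputable def orbitProd (x w : ℝ) (n : ℕ) : ℝ :=
  ∏ k ∈ Finset.range n, x * orbit x w k * Lfun x w k

section
variable {x w : ℝ} (hx0 : 0 < x) (hx : x < 1 / 4) (hw0 : 0 < w) (hw1 : w ≤ 1)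
include hx0 hx hw0 hw1

lemma orbit_mem (j : ℕ) : 0 ≤ orbit x w j ∧ orbit x w j ≤ Cfun x := by
  have hC := (Cfun_spec hx0 hx).2.1
  cases j with
  | zero => exact ⟨hw0.le, hw1.trans hC.le⟩
  | succ j =>
    have := Lfun_mem hx0 hx hw0 hw1 j
    exact ⟨by simp only [orbit]; linarith, this.2⟩

lemma orbitProd_mem (n : ℕ) : 0 ≤ orbitProd x w n ∧ orbitProd x w n ≤ 1 := by
  obtain ⟨h1, h2, h3⟩ := Cfun_spec hx0 hx
  have h0 : ∀ k, 0 ≤ x * orbit x w k * Lfun x w k := fun k => by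
    have := (orbit_mem hx0 hx hw0 hw1 k).1
    have := (Lfun_mem hx0 hx hw0 hw1 k).1
    positivity
  refine ⟨Finset.prod_nonneg fun k _ => h0 k, Finset.prod_le_one (fun k _ => h0 k) fun k _ => ?_⟩
  have ho := orbit_mem hx0 hx hw0 hw1 k
  have hL := Lfun_mem hx0 hx hw0 hw1 k
  calc x * orbit x w k * Lfun x w k ≤ x * Cfun x * Cfun x := by
        have := hL.1
        have := ho.1
        gcongr
        · exact ho.2
        · exact hL.2
    _ ≤ 1 := by nlinarith

lemma orbitProd_succ_eq (j : ℕ) :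
    orbitProd x w (j + 1) = w * Real.sqrt x / (denom x w (j + 1) * denom x w j) := by
  have hs := Real.sqrt_pos.2 hx0
  have h2 := Real.mul_self_sqrt hx0.le
  induction j with
  | zero =>
    obtain ⟨h0, h1, hL⟩ := denom_pos_and_Lfun_eq hx0 hx hw0 hw1 0
    simp only [Nat.cast_zero, zero_add, denom_zero] at *
    simp only [orbitProd, Finset.prod_range_one, orbit, hL]
    field_simp
    linear_combination -h2
  | succ j ih =>
    obtain ⟨h0, h1, hL⟩ := denom_pos_and_Lfun_eq hx0 hx hw0 hw1 j
    obtain ⟨-, h1', hL'⟩ := denom_pos_and_Lfun_eq hx0 hx hw0 hw1 (j + 1)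
    have := ih
    rw [orbitProd, Finset.prod_range_succ, ← orbitProd, ih, orbit, hL, hL']
    push_cast at h1' ⊢
    field_simp
    linear_combination -h2

end

section
variable {x v q w : ℝ} (hx0 : 0 < x) (hx : x < 1 / 4) (hw0 : 0 < w) (hw1 : w ≤ 1)
  (hq0 : 0 < q) (hq : q < 1)
include hx0 hx hw0 hw1

lemma abs_Afun_sub_le (hv0 : 0 ≤ v) (hv : v ≤ 1) (j : ℕ) :
    |Afun x (v * Lfun x w j) - Afun x v| ≤ Afun x (Cfun x) := by
  have hL := Lfun_mem hx0 hx hw0 hw1 j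
  have hC := (Cfun_spec hx0 hx).2.1
  have h1 : v * Lfun x w j ≤ Cfun x := by nlinarith
  have h2 : v ≤ v * Lfun x w j := by nlinarith
  have m1 := Afun_mono hx0 hx hv0 h2 h1
  have m2 := Afun_mono hx0 hx (hv0.trans h2) h1 le_rfl
  have m3 : Afun x 0 ≤ Afun x v := Afun_mono hx0 hx le_rfl hv0 (h2.trans h1)
  simp only [Afun, mul_zero, zero_div] at m3
  rw [abs_of_nonneg (by linarith)]
  have : 0 ≤ Afun x v := m3
  linarith

include hq0 hq

lemma summable_orbitProd_mul {b : ℕ → ℝ} {B : ℝ} (hb : ∀ j, |b j| ≤ B) :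
    Summable fun j : ℕ => q ^ j * orbitProd x w (j + 1) * b j := by
  refine Summable.of_norm_bounded
    ((summable_geometric_of_lt_one hq0.le hq).mul_right B) fun j => ?_
  have hP := orbitProd_mem hx0 hx hw0 hw1 (j + 1)
  rw [Real.norm_eq_abs, abs_mul, abs_mul, abs_of_nonneg hP.1, abs_of_nonneg (by positivity)]
  have hqj : 0 ≤ q ^ j := by positivity
  have : q ^ j * orbitProd x w (j + 1) ≤ q ^ j := mul_le_of_le_one_right hqj hP.2
  gcongr
  exact hb j

variable (hv0 : 0 ≤ v) (hv : v ≤ 1)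
include hv0 hv

lemma markedSum_eq_sum (n : ℕ) :
    markedSum x v q w = q * ∑ j ∈ Finset.range n, q ^ j * orbitProd x w (j + 1) *
      (Afun x (v * Lfun x w j) - Afun x v - markedSum x v q 1) +
      q ^ n * orbitProd x w n * markedSum x v q (orbit x w n) := by
  induction n with
  | zero => simp [orbitProd, orbit]
  | succ n ih =>
    have ho := orbit_mem hx0 hx hw0 hw1 n
    have h := markedSum_eq hx0 hx hv0 hv hq0 hq ho.1 ho.2
    rw [step_orbit] at h
    have hP : orbitProd x w (n + 1) = orbitProd x w n * (x * orbit x w n * Lfun x w n) :=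
      Finset.prod_range_succ _ _
    rw [ih, h, Finset.sum_range_succ, hP, show orbit x w (n + 1) = Lfun x w n from rfl]
    ring

lemma markedSum_eq_tsum :
    markedSum x v q w = q * ∑' j : ℕ, q ^ j * orbitProd x w (j + 1) *
      (Afun x (v * Lfun x w j) - Afun x v - markedSum x v q 1) := by
  have hs := summable_orbitProd_mul hx0 hx hw0 hw1 hq0 hq
    (b := fun j => Afun x (v * Lfun x w j) - Afun x v - markedSum x v q 1)
    (B := Afun x (Cfun x) + |markedSum x v q 1|)
    (fun j => (abs_sub _ _).trans
      (add_le_add_left (abs_Afun_sub_le hx0 hx hw0 hw1 hv0 hv j) _))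
  have hlim : Filter.Tendsto
      (fun n => q ^ n * (orbitProd x w n * markedSum x v q (orbit x w n)))
      Filter.atTop (nhds 0) := by
    refine squeeze_zero (g := fun n => q ^ n * (Afun x (Cfun x) * (1 - q)⁻¹))
      (fun n => ?_) (fun n => ?_) ?_
    · have h1 := (orbitProd_mem hx0 hx hw0 hw1 n).1
      have ho := orbit_mem hx0 hx hw0 hw1 n
      have h2 := (markedSum_mem hx0 hx hv hq0 hq ho.1 ho.2).1
      positivity
    · have h1 := orbitProd_mem hx0 hx hw0 hw1 n
      have ho := orbit_mem hx0 hx hw0 hw1 n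
      have h2 := markedSum_mem hx0 hx hv hq0 hq ho.1 ho.2
      have := mul_le_mul h1.2 h2.2 h2.1 zero_le_one
      rw [one_mul] at this
      gcongr
    · simpa using (tendsto_pow_atTop_nhds_zero_of_lt_one hq0.le hq).mul_const
        (Afun x (Cfun x) * (1 - q)⁻¹)
  have ht := (hs.hasSum.tendsto_sum_nat.const_mul q).add hlim
  rw [add_zero] at ht
  refine tendsto_nhds_unique (tendsto_const_nhds.congr fun n => ?_) ht
  rw [← mul_assoc]
  exact markedSum_eq_sum hx0 hx hw0 hw1 hq0 hq hv0 hv n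

end

section
variable {x v q w : ℝ} (hx0 : 0 < x) (hx : x < 1 / 4) (hv0 : 0 ≤ v) (hv : v ≤ 1)
  (hq0 : 0 < q) (hq : q < 1)
include hx0 hx

lemma orbitProd_one_succ_eq (i : ℕ) :
    orbitProd x 1 (i + 1) = 1 / (Real.sqrt x * chebU ((i : ℤ) + 2) (1 / (2 * Real.sqrt x)) *
      chebU ((i : ℤ) + 1) (1 / (2 * Real.sqrt x))) := by
  have hs := Real.sqrt_pos.2 hx0
  rw [orbitProd_succ_eq hx0 hx one_pos le_rfl, denom_one_eq hx0]
  have := denom_one_eq hx0 ((i : ℤ) - 1)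
  rw [show (i : ℤ) - 1 + 1 = i by ring, show (i : ℤ) - 1 + 2 = i + 1 by ring] at this
  rw [this, one_mul]
  rw [show √x * chebU ((i : ℤ) + 2) (1 / (2 * √x)) * (√x * chebU ((i : ℤ) + 1) (1 / (2 * √x))) =
    √x * (√x * chebU ((i : ℤ) + 2) (1 / (2 * √x)) * chebU ((i : ℤ) + 1) (1 / (2 * √x))) by ring,
    div_mul_eq_div_div, div_self hs.ne']

include hv0 hv hq0 hq

lemma hasSum_numLet (hw0 : 0 ≤ w) (hw1 : w ≤ 1) :
    HasSum (fun p : ℕ × ℕ × ℕ × ℕ =>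
      (numLet (p.1 + 1) p.2.2.2 (p.2.1 + 1) (p.2.2.1 + 1) : ℝ) * x ^ p.2.2.2 *
        w ^ (p.2.2.1 + 1) * v ^ (p.2.1 + 1) * q ^ (p.1 + 1)) (markedSum x v q w) := by
  have hC := (Cfun_spec hx0 hx).2.1.le
  have hwC := hw1.trans hC
  have hX : ENNReal.ofReal x ≠ 0 := by simpa using hx0
  have hfin := finite_isCatalanWord hX (by
    rw [← depthSum_top_eq_letterSum, ← ENNReal.ofReal_one,
      depthSum_top hx0 hx zero_le_one hC]
    exact ENNReal.ofReal_ne_top)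
  have hs : Summable fun i : ℕ => q ^ (i + 1) *
      (letterSum (ENNReal.ofReal x) (ENNReal.ofReal v) (i + 1) (ENNReal.ofReal w)).toReal :=
    (summable_nat_add_iff 1).2 (summable_letterSum hx0 hx hv hq0 hq hw0 hwC)
  have key : ∑' p : ℕ × ℕ × ℕ × ℕ, ENNReal.ofReal
      ((numLet (p.1 + 1) p.2.2.2 (p.2.1 + 1) (p.2.2.1 + 1) : ℝ) * x ^ p.2.2.2 *
        w ^ (p.2.2.1 + 1) * v ^ (p.2.1 + 1) * q ^ (p.1 + 1)) =
      ENNReal.ofReal (markedSum x v q w) := by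
    rw [ENNReal.tsum_prod', markedSum, ENNReal.ofReal_tsum_of_nonneg (fun i => by positivity) hs]
    congr 1; ext i
    rw [ENNReal.ofReal_mul (by positivity), ENNReal.ofReal_toReal (ne_top_of_le_ne_top
      ENNReal.ofReal_ne_top (letterSum_le_ofReal hx0 hx hv hw0 hwC _)), ← tsum_numLet _ _ _ _ hfin,
      mul_comm, ← ENNReal.tsum_mul_right, ENNReal.tsum_prod']
    congr 1; ext s
    rw [← ENNReal.tsum_mul_right, ENNReal.tsum_prod']
    congr 1; ext t
    rw [← ENNReal.tsum_mul_right]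
    congr 1; ext n
    rw [ENNReal.ofReal_mul (by positivity), ENNReal.ofReal_mul (by positivity),
      ENNReal.ofReal_mul (by positivity), ENNReal.ofReal_mul (by positivity),
      ENNReal.ofReal_natCast, ENNReal.ofReal_pow hx0.le, ENNReal.ofReal_pow hw0,
      ENNReal.ofReal_pow hv0]
  have hm := (markedSum_mem hx0 hx hv hq0 hq hw0 hwC).1
  have h := ENNReal.hasSum_toReal (key.trans_ne ENNReal.ofReal_ne_top)
  rw [← ENNReal.tsum_toReal_eq (fun _ => ENNReal.ofReal_ne_top), key,
    ENNReal.toReal_ofReal hm] at h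
  convert h using 2 with p
  rw [ENNReal.toReal_ofReal (by positivity)]

lemma markedSum_one_eq : markedSum x v q 1 =
    (q * ∑' i : ℕ, q ^ i * orbitProd x 1 (i + 1) * (Afun x (v * Lfun x 1 i) - Afun x v)) /
      (1 + q * ∑' i : ℕ, q ^ i * orbitProd x 1 (i + 1)) := by
  have hS₁ := summable_orbitProd_mul hx0 hx one_pos le_rfl hq0 hq
    (abs_Afun_sub_le hx0 hx one_pos le_rfl hv0 hv)
  have hS₂ := summable_orbitProd_mul hx0 hx one_pos le_rfl hq0 hq
    (b := fun _ => 1) (B := 1) (by simp)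
  simp only [mul_one] at hS₂
  have h0 : 0 ≤ ∑' i : ℕ, q ^ i * orbitProd x 1 (i + 1) := tsum_nonneg fun i =>
    mul_nonneg (by positivity) (orbitProd_mem hx0 hx one_pos le_rfl _).1
  have h := markedSum_eq_tsum hx0 hx one_pos le_rfl hq0 hq hv0 hv
  simp only [mul_sub _ _ (markedSum x v q 1)] at h
  rw [hS₁.tsum_sub (hS₂.mul_right _), tsum_mul_right] at h
  rw [eq_div_iff (by positivity)]
  linear_combination h

end

end CatalanSeries

open CatalanSeries in
/-- Closed form for the quadruple series
`Σ_{i≥1} Σ_{s≥1} Σ_{t≥1} Σ_n aᵢ(n,s,t) xⁿ wᵗ vˢ qⁱ` (indexed here by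
`(i,s,t,n) : ℕ⁴` via shifts `i+1, s+1, t+1`), in terms of Chebyshev polynomials
evaluated at `t₀ = 1/(2√x)`. -/
theorem quadruple_series_closed_form (x w v q : ℝ) (hx0 : 0 < x) (hx : x < 1/4)
    (hw0 : 0 < w) (hw1 : w ≤ 1) (hv0 : 0 < v) (hv1 : v ≤ 1) (hq0 : 0 < q) (hq1 : q < 1) :
    let t₀ : ℝ := 1 / (2 * Real.sqrt x);
    let D : ℝ :=
      (q * ∑' i : ℕ, q ^ i * (Afun x (v * Lfun x 1 i) - Afun x v) /
          (Real.sqrt x * chebU ((i : ℤ) + 2) t₀ * chebU ((i : ℤ) + 1) t₀)) /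
        (1 + q * ∑' i : ℕ, q ^ i /
          (Real.sqrt x * chebU ((i : ℤ) + 2) t₀ * chebU ((i : ℤ) + 1) t₀));
    Summable (fun p : ℕ × ℕ × ℕ × ℕ =>
      (numLet (p.1 + 1) p.2.2.2 (p.2.1 + 1) (p.2.2.1 + 1) : ℝ) * x ^ p.2.2.2 *
        w ^ (p.2.2.1 + 1) * v ^ (p.2.1 + 1) * q ^ (p.1 + 1)) ∧
    ∑' p : ℕ × ℕ × ℕ × ℕ,
      (numLet (p.1 + 1) p.2.2.2 (p.2.1 + 1) (p.2.2.1 + 1) : ℝ) * x ^ p.2.2.2 *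
        w ^ (p.2.2.1 + 1) * v ^ (p.2.1 + 1) * q ^ (p.1 + 1) =
      q * ∑' j : ℕ, w * Real.sqrt x * q ^ j * (Afun x (v * Lfun x w j) - Afun x v - D) /
        ((chebU ((j : ℤ) + 1) t₀ - w * Real.sqrt x * chebU (j : ℤ) t₀) *
          (chebU (j : ℤ) t₀ - w * Real.sqrt x * chebU ((j : ℤ) - 1) t₀)) := by
  intro t₀ D
  have hD : markedSum x v q 1 = D := by
    rw [markedSum_one_eq hx0 hx hv0.le hv1 hq0 hq1]
    simp only [orbitProd_one_succ_eq hx0 hx, mul_one_div, div_mul_eq_mul_div, D, t₀]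
  have h := hasSum_numLet hx0 hx hv0.le hv1 hq0 hq1 hw0.le hw1
  refine ⟨h.summable, h.tsum_eq.trans ?_⟩
  rw [markedSum_eq_tsum hx0 hx hw0 hw1 hq0 hq1 hv0.le hv1, hD]
  congr 2; ext j
  rw [orbitProd_succ_eq hx0 hx hw0 hw1, denom, denom, add_sub_cancel_right]
  ring
end

section
/- Let x, w, q be real numbers with 0 < x < 1/4, 0 < w ≤ 1 and 0 < q < 1, and set t₀ = 1/(2√x). Then the triple series Σ_{i≥1} Σ_{t≥1} Σ_{n≥t} a_i(n,0,t)·x^n·w^t·q^i converges and equals [ q·Σ_{j≥0} w·√x·q^j / ( (U_{j+1}(t₀) − w√x·U_j(t₀))·(U_j(t₀) − w√x·U_{j−1}(t₀)) ) ] / [ (1−q)·( 1 + q·Σ_{j≥0} q^j/( √x·U_{j+2}(t₀)·U_{j+1}(t₀) ) ) ]. -/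
/-- List form of `IsCatalanWord`. -/
def IsCatalanList (l : List ℕ) : Prop :=
  l.IsChain (fun a b => a ≤ b + 1) ∧
  ∀ k p s, l = p ++ (k + 1) :: s → k + 1 ∉ p → k ∈ p ∧ k ∈ s

/-- Delete the zeros of a word and decrease the other letters by one. -/
def decr (l : List ℕ) : List ℕ := l.filterMap Nat.ppred

@[simp] lemma decr_nil : decr [] = [] := rfl
@[simp] lemma decr_zero_cons (l : List ℕ) : decr (0 :: l) = decr l := rfl
@[simp] lemma decr_succ_cons (k : ℕ) (l : List ℕ) : decr ((k + 1) :: l) = k :: decr l := rfl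
@[simp] lemma decr_append (l r : List ℕ) : decr (l ++ r) = decr l ++ decr r :=
  List.filterMap_append
@[simp] lemma mem_decr {k : ℕ} {l : List ℕ} : k ∈ decr l ↔ k + 1 ∈ l := by
  simp [decr, List.mem_filterMap, Nat.ppred_eq_some]
@[simp] lemma decr_replicate_zero (c : ℕ) : decr (List.replicate c 0) = [] := by
  induction c <;> simp_all [List.replicate_succ]
@[simp] lemma decr_map_succ (u : List ℕ) : decr (u.map (· + 1)) = u := by
  induction u <;> simp_all

lemma length_eq_decr_add_count (l : List ℕ) : l.length = (decr l).length + l.count 0 := by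
  induction l with
  | nil => rfl
  | cons a l ih => cases a <;> simp [ih] <;> omega

lemma decr_eq_nil {l : List ℕ} : decr l = [] ↔ ∀ a ∈ l, a = 0 := by
  induction l with
  | nil => simp
  | cons a l ih => cases a <;> simp [ih]

lemma map_succ_decr {l : List ℕ} (h : 0 ∉ l) : (decr l).map (· + 1) = l := by
  induction l with
  | nil => rfl
  | cons a l ih => cases a <;> simp_all

lemma exists_of_decr_eq_append_cons {l p s : List ℕ} {k : ℕ} (h : decr l = p ++ k :: s) :
    ∃ p' s', l = p' ++ (k + 1) :: s' ∧ decr p' = p ∧ decr s' = s := by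
  induction l generalizing p with
  | nil => simp at h
  | cons a l ih =>
    cases a with
    | zero =>
      obtain ⟨p', s', rfl, h1, h2⟩ := ih h
      exact ⟨0 :: p', s', by simp, by simpa, h2⟩
    | succ a =>
      cases p with
      | nil =>
        simp only [decr_succ_cons, List.nil_append, List.cons.injEq] at h
        exact ⟨[], l, by simp [h.1], rfl, h.2⟩
      | cons b p =>
        simp only [decr_succ_cons, List.cons_append, List.cons.injEq] at h
        obtain ⟨p', s', rfl, h1, h2⟩ := ih h.2
        exact ⟨(a + 1) :: p', s', by simp, by simp [h1, h.1], h2⟩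

/-- Each zero of the word is at the front or preceded by a letter at most `1`. -/
def ZeroChain (l : List ℕ) : Prop := l.IsChain (fun a b => b = 0 → a ≤ 1)

lemma isChain_iff_decr (l : List ℕ) :
    l.IsChain (fun a b => a ≤ b + 1) ↔
      (decr l).IsChain (fun a b => a ≤ b + 1) ∧ ZeroChain l := by
  unfold ZeroChain
  induction l with
  | nil => simp
  | cons a l ih =>
    rw [List.isChain_cons, List.isChain_cons, ih]
    cases a with
    | zero => simp
    | succ k =>
      rw [decr_succ_cons, List.isChain_cons]
      have : (∀ y ∈ l.head?, k + 1 ≤ y + 1) ↔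
          (∀ y ∈ (decr l).head?, k ≤ y + 1) ∧ (∀ y ∈ l.head?, y = 0 → k + 1 ≤ 1) := by
        rcases l with _ | ⟨_ | b, l⟩
        · simp
        · simp
          rintro rfl; simp
        · simp
      rw [this]; tauto

lemma IsCatalanList.head_eq_zero {a : ℕ} {l : List ℕ} (h : IsCatalanList (a :: l)) : a = 0 := by
  cases a with
  | zero => rfl
  | succ k => simpa using h.2 k [] l rfl

lemma IsCatalanList.mem_of_succ_mem {k : ℕ} {l : List ℕ} (h : IsCatalanList l)
    (hk : k + 1 ∈ l) : k ∈ l := by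
  obtain ⟨p, s, rfl, hp⟩ := List.eq_append_cons_of_mem hk
  simp [(h.2 k p s rfl hp).1]

lemma IsCatalanList.mem_of_le {j k : ℕ} {l : List ℕ} (h : IsCatalanList l)
    (hk : k ∈ l) (hjk : j ≤ k) : j ∈ l := by
  induction k, hjk using Nat.le_induction with
  | base => exact hk
  | succ k _ ih => exact ih (h.mem_of_succ_mem hk)

lemma isCatalanList_iff_decr {l : List ℕ} (hl : decr l ≠ []) :
    IsCatalanList l ↔ IsCatalanList (decr l) ∧ ZeroChain l ∧ l.head? = some 0 ∧
      ¬ ∃ c, l = List.replicate (c + 1) 0 ++ (decr l).map (· + 1) := by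
  constructor
  · intro h
    have hc := (isChain_iff_decr l).1 h.1
    have hd : IsCatalanList (decr l) := by
      refine ⟨hc.1, fun k p s he hk => ?_⟩
      obtain ⟨p', s', h', rfl, rfl⟩ := exists_of_decr_eq_append_cons he
      simpa using h.2 (k + 1) p' s' h' (by simpa using hk)
    refine ⟨hd, hc.2, ?_, ?_⟩
    · cases l with
      | nil => simp at hl
      | cons a l => simp [h.head_eq_zero]
    · rintro ⟨c, hc⟩
      obtain ⟨a, u, hu⟩ := List.exists_cons_of_ne_nil hl
      rw [hu] at hd hc
      obtain rfl := hd.head_eq_zero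
      have := h.2 0 (List.replicate (c + 1) 0) (u.map (· + 1)) (by simpa using hc)
        (by simp)
      simp at this
  · rintro ⟨hd, hz, h0, hr⟩
    refine ⟨(isChain_iff_decr l).2 ⟨hd.1, hz⟩, fun k p s he hk => ?_⟩
    cases k with
    | succ k =>
      have := hd.2 k (decr p) (decr s) (by simp [he]) (by simpa using hk)
      simpa using this
    | zero =>
      have hp : ∀ a ∈ p, a = 0 := by
        rw [← decr_eq_nil]
        cases hq : decr p with
        | nil => rfl
        | cons b q =>
          rw [he, decr_append, hq] at hd
          have hb : b = 0 := hd.head_eq_zero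
          exact absurd (mem_decr.1 (by simp [hq, hb] : 0 ∈ decr p)) hk
      obtain ⟨c, rfl⟩ : ∃ c, p = List.replicate c 0 :=
        ⟨_, List.eq_replicate_iff.2 ⟨rfl, hp⟩⟩
      cases c with
      | zero => simp [he] at h0
      | succ c =>
        refine ⟨by simp, ?_⟩
        by_contra hs
        refine hr ⟨c, ?_⟩
        rw [he]
        simp [map_succ_decr hs]

open scoped ENNReal

/-- The words inflating `u` by inserted zeros that keep descents at most one. -/
def zeroFiber (u : List ℕ) : Set (List ℕ) := {l | decr l = u ∧ ZeroChain l}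

/-- The members of `zeroFiber u` that do not start with a zero. -/
def zeroFiberPos (u : List ℕ) : Set (List ℕ) := {l | l ∈ zeroFiber u ∧ l.head? ≠ some 0}

lemma zeroChain_replicate_append (c : ℕ) {l : List ℕ} :
    ZeroChain (List.replicate c 0 ++ l) ↔ ZeroChain l := by
  induction c with
  | zero => simp
  | succ c ih =>
    rw [← ih, List.replicate_succ, List.cons_append]
    simp [ZeroChain, List.isChain_cons]

lemma zeroChain_zero_cons {l : List ℕ} : ZeroChain (0 :: l) ↔ ZeroChain l :=
  zeroChain_replicate_append 1

lemma exists_eq_replicate_append (l : List ℕ) :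
    ∃ c l', l = List.replicate c 0 ++ l' ∧ l'.head? ≠ some 0 := by
  induction l with
  | nil => exact ⟨0, [], by simp⟩
  | cons a l ih =>
    cases a with
    | zero =>
      obtain ⟨c, l', rfl, h⟩ := ih
      exact ⟨c + 1, l', by simp [List.replicate_succ], h⟩
    | succ a => exact ⟨0, (a + 1) :: l, by simp⟩

lemma replicate_append_inj {c d : ℕ} {l r : List ℕ} (hl : l.head? ≠ some 0)
    (hr : r.head? ≠ some 0) (h : List.replicate c 0 ++ l = List.replicate d 0 ++ r) :
    c = d ∧ l = r := by
  induction c generalizing d with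
  | zero =>
    cases d with
    | zero => simpa using h
    | succ d => simp [List.replicate_succ] at h; simp [h] at hl
  | succ c ih =>
    cases d with
    | zero => simp [List.replicate_succ] at h; simp [← h] at hr
    | succ d =>
      simp only [List.replicate_succ, List.cons_append, List.cons.injEq, true_and] at h
      simpa using ih h

lemma tsum_zeroFiber (z : ℝ≥0∞) (u : List ℕ) :
    ∑' l : zeroFiber u, z ^ (l : List ℕ).count 0 =
      (1 - z)⁻¹ * ∑' l : zeroFiberPos u, z ^ (l : List ℕ).count 0 := by
  let g : ℕ × zeroFiberPos u → List ℕ := fun p => List.replicate p.1 0 ++ p.2.1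
  have hg : g.Injective := by
    rintro ⟨c, l⟩ ⟨d, r⟩ h
    obtain ⟨hcd, hlr⟩ := replicate_append_inj l.2.2 r.2.2 h
    exact Prod.ext hcd (Subtype.ext hlr)
  have hr : zeroFiber u = Set.range g := by
    ext l
    constructor
    · rintro ⟨rfl, hz⟩
      obtain ⟨c, l', rfl, h⟩ := exists_eq_replicate_append l
      exact ⟨(c, ⟨l', ⟨by simp, (zeroChain_replicate_append c).1 hz⟩, h⟩), rfl⟩
    · rintro ⟨⟨c, l, ⟨rfl, hz⟩, h⟩, rfl⟩
      exact ⟨by simp [g], (zeroChain_replicate_append c).2 hz⟩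
  rw [hr, tsum_range (fun l => z ^ l.count 0) hg, ENNReal.tsum_prod', ← ENNReal.tsum_geometric,
    ← ENNReal.tsum_mul_right]
  refine tsum_congr fun c => ?_
  rw [← ENNReal.tsum_mul_left]
  exact tsum_congr fun l => by simp [g, pow_add]

lemma zeroFiberPos_nil : zeroFiberPos [] = {[]} := by
  ext l
  rcases l with _ | ⟨_ | a, l⟩ <;> simp [zeroFiberPos, zeroFiber, ZeroChain]

lemma zeroFiberPos_zero_cons (u : List ℕ) :
    zeroFiberPos (0 :: u) = List.cons 1 '' zeroFiber u := by
  ext l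
  rcases l with _ | ⟨_ | a, l⟩
  · simp [zeroFiberPos, zeroFiber]
  · simp [zeroFiberPos]
  · simp [zeroFiberPos, zeroFiber, ZeroChain, List.isChain_cons]
    grind

lemma zeroFiberPos_succ_cons (k : ℕ) (u : List ℕ) :
    zeroFiberPos ((k + 1) :: u) = List.cons (k + 2) '' zeroFiberPos u := by
  ext l
  rcases l with _ | ⟨_ | a, _ | ⟨_ | b, l⟩⟩ <;>
    simp [zeroFiberPos, zeroFiber, ZeroChain, List.isChain_cons] <;> grind

lemma tsum_zeroFiberPos (z : ℝ≥0∞) (u : List ℕ) :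
    ∑' l : zeroFiberPos u, z ^ (l : List ℕ).count 0 = ((1 - z)⁻¹) ^ u.count 0 := by
  induction u with
  | nil => rw [zeroFiberPos_nil, tsum_singleton [] (fun l : List ℕ => z ^ l.count 0)]; simp
  | cons a u ih =>
    cases a with
    | zero =>
      rw [zeroFiberPos_zero_cons, tsum_image (fun l : List ℕ => z ^ l.count 0)
        (List.cons_injective.injOn)]
      simp only [ne_eq, one_ne_zero, not_false_eq_true, List.count_cons_of_ne,
        List.count_cons_self, tsum_zeroFiber, ih, pow_succ']
    | succ k =>
      rw [zeroFiberPos_succ_cons, tsum_image (fun l : List ℕ => z ^ l.count 0)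
        (List.cons_injective.injOn)]
      simpa using ih

/-- Catalan words whose largest letter is `m`. -/
def heightSet (m : ℕ) : Set (List ℕ) := {l | IsCatalanList l ∧ m ∈ l ∧ m + 1 ∉ l}

/-- Generating function of the Catalan words with largest letter `m`. -/
noncomputable def heightGF (x : ℝ≥0∞) (m : ℕ) (w : ℝ≥0∞) : ℝ≥0∞ :=
  ∑' l : heightSet m, x ^ (l : List ℕ).length * w ^ (l : List ℕ).count 0

lemma heightSet_zero : heightSet 0 = Set.range (fun c => List.replicate (c + 1) 0) := by
  ext l
  constructor
  · rintro ⟨h, h0, h1⟩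
    have h : ∀ a ∈ l, a = 0 := by
      intro a ha
      by_contra h'
      exact h1 (h.mem_of_le ha (by omega))
    have hl := List.length_pos_of_mem h0
    exact ⟨l.length - 1, (List.eq_replicate_iff.2 ⟨by omega, h⟩).symm⟩
  · rintro ⟨c, rfl⟩
    refine ⟨⟨?_, ?_⟩, by simp, by simp⟩
    · exact List.isChain_replicate_of_rel _ (by simp)
    · intro k p s h
      have : k + 1 ∈ List.replicate (c + 1) 0 := by simp [show List.replicate (c + 1) 0 = _ from h]
      simp at this

lemma heightGF_zero (x w : ℝ≥0∞) : heightGF x 0 w = w * x * (1 - w * x)⁻¹ := by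
  have hg : Function.Injective (fun c => List.replicate (c + 1) (0 : ℕ)) := by
    intro c d h
    simpa using congrArg List.length h
  rw [heightGF, heightSet_zero,
    tsum_range (fun l : List ℕ => x ^ l.length * w ^ l.count 0) hg, ← ENNReal.tsum_geometric,
    ← ENNReal.tsum_mul_left]
  refine tsum_congr fun c => ?_
  simp only [List.length_replicate, List.count_replicate_self, ← mul_pow, ← pow_succ', mul_comm]

lemma heightGF_succ (x w : ℝ≥0∞) (m : ℕ) :
    heightGF x (m + 1) w + w * x * (1 - w * x)⁻¹ * heightGF x m 1 =
      w * x * (1 - w * x)⁻¹ * heightGF x m (1 - w * x)⁻¹ := by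
  let f : List ℕ → ℝ≥0∞ := fun l => x ^ l.length * w ^ l.count 0
  have hf : ∀ l, f l = x ^ (decr l).length * (w * x) ^ l.count 0 := fun l => by
    simp only [f]
    rw [length_eq_decr_add_count l, pow_add, mul_pow]; ring
  let g₁ : ℕ × heightSet m → List ℕ :=
    fun p => List.replicate (p.1 + 1) 0 ++ p.2.1.map (· + 1)
  have hg₁ : g₁.Injective := by
    rintro ⟨c, u⟩ ⟨d, v⟩ h
    have h1 := congrArg decr h
    have h2 := congrArg List.length h
    simp only [g₁, decr_append, decr_replicate_zero, decr_map_succ, List.nil_append] at h1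
    simp [g₁, h1] at h2
    simp [h2, Subtype.ext_iff, h1]
  let g₂ : (Σ u : heightSet m, zeroFiber u.1) → List ℕ := fun p => 0 :: p.2.1
  have hg₂ : g₂.Injective := by
    rintro ⟨⟨u, hu⟩, ⟨l, hlu : decr l = u, hl⟩⟩ ⟨⟨v, hv⟩, ⟨r, hrv : decr r = v, hr⟩⟩ h
    subst hlu hrv
    obtain rfl : l = r := List.cons_injective h
    rfl
  have hne : ∀ {u}, u ∈ heightSet m → u ≠ [] := by
    rintro u ⟨-, h, -⟩ rfl
    simp at h
  have hdisj : Disjoint (heightSet (m + 1)) (Set.range g₁) := by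
    rw [Set.disjoint_left]
    rintro _ h ⟨⟨c, u⟩, rfl⟩
    have := ((isCatalanList_iff_decr (by simpa [g₁] using hne u.2)).1 h.1).2.2.2
    exact this ⟨c, by simp [g₁]⟩
  have hunion : heightSet (m + 1) ∪ Set.range g₁ = Set.range g₂ := by
    ext l
    constructor
    · rintro (h | ⟨⟨c, u⟩, rfl⟩)
      · have hd : decr l ≠ [] := List.ne_nil_of_mem (mem_decr.2 h.2.1)
        obtain ⟨h1, h2, h3, -⟩ := (isCatalanList_iff_decr hd).1 h.1
        rcases l with _ | ⟨a, l⟩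
        · simp at h3
        · simp at h3
          subst h3
          exact ⟨⟨⟨decr l, h1, mem_decr.2 (by simpa using h.2.1), by simpa using h.2.2⟩,
            ⟨l, rfl, zeroChain_zero_cons.1 h2⟩⟩, rfl⟩
      · refine ⟨⟨u, ⟨List.replicate c 0 ++ u.1.map (· + 1), by simp, ?_⟩⟩, by
          simp [g₁, g₂, List.replicate_succ]⟩
        rw [zeroChain_replicate_append]
        refine List.Pairwise.isChain (List.pairwise_of_forall_mem_list ?_)
        simp
    · rintro ⟨⟨⟨u, hu⟩, ⟨l, hlu : decr l = u, hl⟩⟩, rfl⟩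
      subst hlu
      have hd : decr (0 :: l) ≠ [] := by simpa using hne hu
      by_cases h : ∃ c, 0 :: l = List.replicate (c + 1) 0 ++ (decr (0 :: l)).map (· + 1)
      · obtain ⟨c, h⟩ := h
        exact Or.inr ⟨⟨c, ⟨decr l, hu⟩⟩, h.symm⟩
      · exact Or.inl ⟨(isCatalanList_iff_decr hd).2
          ⟨hu.1, zeroChain_zero_cons.2 hl, rfl, h⟩, by simpa [g₂] using hu.2.1,
          by simpa [g₂] using hu.2.2⟩
  have h₁ : ∑' l : Set.range g₁, f l = w * x * (1 - w * x)⁻¹ * heightGF x m 1 := by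
    rw [tsum_range f hg₁, ENNReal.tsum_prod', ← ENNReal.tsum_geometric, ← ENNReal.tsum_mul_left,
      ← ENNReal.tsum_mul_right]
    refine tsum_congr fun c => ?_
    rw [heightGF, ← ENNReal.tsum_mul_left]
    refine tsum_congr fun u => ?_
    have : (u.1.map (· + 1)).count 0 = 0 := List.count_eq_zero.2 (by simp)
    rw [hf]
    simp [g₁, this, pow_succ]
    ring
  have h₂ : ∑' l : Set.range g₂, f l =
      w * x * (1 - w * x)⁻¹ * heightGF x m (1 - w * x)⁻¹ := by
    rw [tsum_range f hg₂, ENNReal.tsum_sigma', heightGF, ← ENNReal.tsum_mul_left]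
    refine tsum_congr fun u => ?_
    have : ∀ l : zeroFiber u.1, f (g₂ ⟨u, l⟩) =
        w * x * x ^ u.1.length * (w * x) ^ l.1.count 0 := fun l => by
      rw [hf]
      simp only [g₂, decr_zero_cons, l.2.1, List.count_cons_self, pow_succ]
      ring
    simp only [this, ENNReal.tsum_mul_left, tsum_zeroFiber, tsum_zeroFiberPos]
    ring
  rw [← h₁, ← h₂, ← hunion, ENNReal.summable.tsum_union_disjoint hdisj ENNReal.summable]
  rfl

/-- The generating function obtained from the recursion for `heightGF` by dropping the
correction term. -/
noncomputable def chainGF (x : ℝ≥0∞) : ℕ → ℝ≥0∞ → ℝ≥0∞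
  | 0, w => w * x * (1 - w * x)⁻¹
  | k + 1, w => w * x * (1 - w * x)⁻¹ * chainGF x k (1 - w * x)⁻¹

lemma heightGF_add_sum (x : ℝ≥0∞) (m : ℕ) (w : ℝ≥0∞) :
    heightGF x m w + ∑ k ∈ Finset.range m, chainGF x k w * heightGF x (m - 1 - k) 1 =
      chainGF x m w := by
  induction m generalizing w with
  | zero => simp [heightGF_zero, chainGF]
  | succ m ih =>
    rw [Finset.sum_range_succ', chainGF, chainGF, ← ih, mul_add, ← heightGF_succ, Finset.mul_sum]
    simp only [chainGF, add_tsub_cancel_right, tsub_zero, mul_assoc, add_assoc]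
    congr 1
    rw [add_comm]
    congr 1
    refine Finset.sum_congr rfl fun k _ => ?_
    rw [show m - (k + 1) = m - 1 - k by omega]

lemma ENNReal.tsum_mul_tsum_eq_tsum_sum_range (f g : ℕ → ℝ≥0∞) :
    (∑' n, f n) * ∑' n, g n = ∑' n, ∑ k ∈ Finset.range (n + 1), f k * g (n - k) := by
  simp_rw [← Finset.Nat.sum_antidiagonal_eq_sum_range_succ (fun i j => f i * g j)]
  rw [← ENNReal.tsum_mul_right]
  simp_rw [← ENNReal.tsum_mul_left]
  rw [← ENNReal.tsum_prod, ← Finset.HasAntidiagonal.sigmaAntidiagonalEquivProd.tsum_eq, ENNReal.tsum_sigma']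
  refine tsum_congr fun n => ?_
  rw [tsum_fintype, ← Finset.sum_coe_sort (Finset.HasAntidiagonal.antidiagonal n)]
  rfl

lemma tsum_heightGF (x q w : ℝ≥0∞) :
    ∑' m, q ^ (m + 1) * heightGF x m w +
        (∑' m, q ^ (m + 1) * chainGF x m w) * ∑' m, q ^ (m + 1) * heightGF x m 1 =
      ∑' m, q ^ (m + 1) * chainGF x m w := by
  have : (∑' m, q ^ (m + 1) * chainGF x m w) * ∑' m, q ^ (m + 1) * heightGF x m 1 =
      ∑' m, q ^ (m + 1) *
        ∑ k ∈ Finset.range m, chainGF x k w * heightGF x (m - 1 - k) 1 := by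
    rw [ENNReal.tsum_mul_tsum_eq_tsum_sum_range, tsum_eq_zero_add' ENNReal.summable (f := fun m =>
      q ^ (m + 1) * ∑ k ∈ Finset.range m, chainGF x k w * heightGF x (m - 1 - k) 1)]
    simp only [Finset.range_zero, Finset.sum_empty, mul_zero, zero_add, Finset.mul_sum]
    refine tsum_congr fun n => Finset.sum_congr rfl fun k hk => ?_
    obtain ⟨j, rfl⟩ := Nat.exists_eq_add_of_le (Finset.mem_range_succ_iff.1 hk)
    simp only [add_tsub_cancel_right, add_tsub_cancel_left]
    ring
  rw [this, ← ENNReal.tsum_add]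
  exact tsum_congr fun m => by rw [← mul_add, heightGF_add_sum]

lemma exists_mem_heightSet {l : List ℕ} (h : IsCatalanList l) (h0 : 0 ∈ l) :
    ∃ m, l ∈ heightSet m := by
  have hne : l.toFinset.Nonempty := ⟨0, by simpa⟩
  refine ⟨l.toFinset.max' hne, h, by simpa using l.toFinset.max'_mem hne, fun hm => ?_⟩
  have := l.toFinset.le_max' _ (List.mem_toFinset.2 hm)
  omega

lemma succ_notMem_iff {l : List ℕ} {m i : ℕ} (h : l ∈ heightSet m) : i + 1 ∉ l ↔ m ≤ i := by
  constructor
  · intro hi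
    by_contra! hmi
    exact hi (h.1.mem_of_le h.2.1 hmi)
  · intro hi hm
    exact h.2.2 (h.1.mem_of_le hm (by omega))

lemma IsCatalanList.lt_length {l : List ℕ} (h : IsCatalanList l) {k : ℕ} (hk : k ∈ l) :
    k < l.length := by
  have : Finset.range (k + 1) ⊆ l.toFinset := fun j hj =>
    List.mem_toFinset.2 (h.mem_of_le hk (Finset.mem_range_succ_iff.1 hj))
  have := (Finset.card_le_card this).trans l.toFinset_card_le
  simpa using this

/-- List form of the set counted by `numLet`. -/
def letterSet (i n s t : ℕ) : Set (List ℕ) :=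
  {l | IsCatalanList l ∧ l.length = n ∧ l.count i = s ∧ l.count 0 = t}

lemma isCatalanWord_get (l : List ℕ) : IsCatalanWord l.get ↔ IsCatalanList l := by
  refine and_congr ?_ ?_
  · rw [List.isChain_iff_getElem]
    simp only [List.get_eq_getElem]
  · constructor
    · rintro h k p s rfl hp
      have hl : p.length < (p ++ (k + 1) :: s).length := by simp
      obtain ⟨⟨i, hi, h1⟩, ⟨j, hj, h2⟩⟩ := h ⟨p.length, hl⟩ (by simp) (by
        intro j hj
        by_contra! hlt
        have hlt : j.1 < p.length := hlt
        apply hp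
        simp only [List.get_eq_getElem, List.getElem_append_left hlt] at hj
        simp at hj
        rw [← hj]
        exact List.getElem_mem _)
      have hi : i.1 < p.length := hi
      have hj : p.length < j.1 := hj
      constructor
      · simp [List.getElem_append_left hi] at h1
        rw [← h1]
        exact List.getElem_mem _
      · obtain ⟨d, hd⟩ := Nat.exists_eq_add_of_lt hj
        have hjl := j.2
        simp [hd] at hjl
        have : (p ++ (k + 1) :: s)[j.1] = s[d]'(by omega) := by
          simp [hd, List.getElem_append_right, add_assoc]
        simp [this] at h2
        rw [← h2]
        exact List.getElem_mem _
    · intro h i hi hmin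
      obtain ⟨k, hk⟩ := Nat.exists_eq_add_of_lt hi
      simp only [zero_add] at hk
      have hl : l = l.take i ++ (k + 1) :: l.drop (i + 1) := by
        rw [← hk]; simp
      obtain ⟨h1, h2⟩ := h k _ _ hl (by
        intro hm
        obtain ⟨j, hj, hj'⟩ := List.getElem_of_mem hm
        simp at hj hj'
        have : i.1 ≤ j := hmin ⟨j, by omega⟩ (by simpa [hj'] using hk.symm)
        omega)
      rw [hk]
      constructor
      · obtain ⟨j, hj, hj'⟩ := List.getElem_of_mem h1
        simp at hj hj'
        exact ⟨⟨j, by omega⟩, hj, by simp [hj']⟩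
      · obtain ⟨j, hj, hj'⟩ := List.getElem_of_mem h2
        simp at hj hj'
        exact ⟨⟨i + 1 + j, by omega⟩, by simp [Fin.lt_def]; omega, by simp [hj']⟩

lemma isCatalanWord_iff_ofFn {n : ℕ} (a : Fin n → ℕ) :
    IsCatalanWord a ↔ IsCatalanList (List.ofFn a) := by
  suffices h : ∀ s : Σ n, Fin n → ℕ, IsCatalanWord s.2 ↔ IsCatalanList (List.ofFn s.2) from
    h ⟨n, a⟩
  intro s
  obtain ⟨l, rfl⟩ := List.equivSigmaTuple.surjective s
  simp [List.equivSigmaTuple, isCatalanWord_get]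

lemma countEq_eq_count {n : ℕ} (a : Fin n → ℕ) (c : ℕ) : countEq a c = (List.ofFn a).count c := by
  induction n with
  | zero => simp [countEq, Set.eq_empty_of_isEmpty]
  | succ n ih =>
    have h : {i : Fin (n + 1) | a i = c} =
        {i | i = 0 ∧ a 0 = c} ∪ Fin.succ '' {i : Fin n | a i.succ = c} := by
      ext i
      cases i using Fin.cases <;> simp
    have hd : Disjoint {i | i = 0 ∧ a 0 = c} (Fin.succ '' {i : Fin n | a i.succ = c}) := by
      rw [Set.disjoint_left]
      rintro _ ⟨rfl, -⟩
      simp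
    have hi := ih (fun i => a i.succ)
    unfold countEq at hi ⊢
    rw [h, Set.ncard_union_eq hd, Set.ncard_image_of_injective _ (Fin.succ_injective n), hi,
      List.ofFn_succ, List.count_cons]
    by_cases h0 : a 0 = c <;> simp [h0, add_comm]

lemma numLet_eq_encard (i n s t : ℕ) :
    ((numLet i n s t : ℕ) : ℕ∞) = (letterSet i n s t).encard := by
  have himage : List.ofFn '' {a : Fin n → ℕ | IsCatalanWord a ∧ countEq a i = s ∧
      countEq a 0 = t} = letterSet i n s t := by
    ext l
    simp only [isCatalanWord_iff_ofFn, countEq_eq_count, letterSet]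
    constructor
    · rintro ⟨a, ⟨h1, h2, h3⟩, rfl⟩
      exact ⟨h1, by simp, h2, h3⟩
    · rintro ⟨h1, rfl, h2, h3⟩
      exact ⟨l.get, by simpa using ⟨h1, h2, h3⟩, by simp⟩
  have hfin : {a : Fin n → ℕ | IsCatalanWord a ∧ countEq a i = s ∧ countEq a 0 = t}.Finite := by
    refine (Set.finite_Iic (fun _ : Fin n => n)).subset fun a ha j => ?_
    have := ((isCatalanWord_iff_ofFn a).1 ha.1).lt_length (k := a j)
      (by simp [List.mem_ofFn])
    simp at this
    exact this.le
  rw [numLet, hfin.cast_ncard_eq, ← himage, List.ofFn_injective.encard_image]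

open Classical in
lemma tsum_ite_letterSet (x w q : ℝ≥0∞) (l : List ℕ) :
    ∑' p : ℕ × ℕ × ℕ,
      (if l ∈ letterSet (p.1 + 1) (p.2.1 + 1 + p.2.2) 0 (p.2.1 + 1) then
        x ^ (p.2.1 + 1 + p.2.2) * w ^ (p.2.1 + 1) * q ^ (p.1 + 1) else 0) =
    ∑' m, if l ∈ heightSet m then
      (1 - q)⁻¹ * q ^ (m + 1) * (x ^ l.length * w ^ l.count 0) else 0 := by
  by_cases h : IsCatalanList l ∧ 0 ∈ l
  · obtain ⟨m, hm⟩ := exists_mem_heightSet h.1 h.2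
    have hpos := List.count_pos_iff.2 h.2
    have hle := List.count_le_length (a := 0) (l := l)
    have h2 : l.count 0 - 1 + 1 = l.count 0 := by omega
    have h3 : l.count 0 + (l.length - l.count 0) = l.length := by omega
    rw [tsum_eq_single m, if_pos hm]
    · let g : ℕ → ℕ × ℕ × ℕ := fun j => (m + j, l.count 0 - 1, l.length - l.count 0)
      have hg : g.Injective := fun j k hjk => by simpa [g] using hjk
      rw [← hg.tsum_eq, ← ENNReal.tsum_geometric, ← ENNReal.tsum_mul_right,
        ← ENNReal.tsum_mul_right]
      · refine tsum_congr fun j => ?_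
        rw [if_pos]
        · simp only [g, h2, h3]
          ring
        · refine ⟨h.1, by simp only [g, h2, h3], ?_, by simp only [g, h2]⟩
          exact List.count_eq_zero.2 ((succ_notMem_iff hm).2 (by simp [g]))
      · rintro ⟨i, t, k⟩ hp
        simp only [Function.mem_support, ne_eq, ite_eq_right_iff, not_forall] at hp
        obtain ⟨⟨-, h4, h5, h6⟩, -⟩ := hp
        have := (succ_notMem_iff hm).1 (List.count_eq_zero.1 h5)
        exact ⟨i - m, by simp only [g, Prod.mk.injEq]; omega⟩
    · intro k hk
      rw [if_neg]
      intro hk'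
      have h4 := (succ_notMem_iff hm (i := k)).1 hk'.2.2
      have h5 := (succ_notMem_iff hk' (i := m)).1 hm.2.2
      omega
  · rw [ENNReal.tsum_eq_zero.2, ENNReal.tsum_eq_zero.2]
    · intro m
      rw [if_neg]
      rintro ⟨h1, h2, -⟩
      exact h ⟨h1, h1.mem_of_le h2 (Nat.zero_le m)⟩
    · rintro p
      rw [if_neg]
      rintro ⟨h1, -, -, h2⟩
      exact h ⟨h1, List.count_pos_iff.1 (by omega)⟩

lemma tsum_numLet (x w q : ℝ≥0∞) :
    ∑' p : ℕ × ℕ × ℕ,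
      (numLet (p.1 + 1) (p.2.1 + 1 + p.2.2) 0 (p.2.1 + 1) : ℝ≥0∞) * x ^ (p.2.1 + 1 + p.2.2) *
        w ^ (p.2.1 + 1) * q ^ (p.1 + 1) =
      (1 - q)⁻¹ * ∑' m, q ^ (m + 1) * heightGF x m w := by
  classical
  have h1 : ∀ i n s t (c : ℝ≥0∞), (numLet i n s t : ℝ≥0∞) * c =
      ∑' l : List ℕ, if l ∈ letterSet i n s t then c else 0 := by
    intro i n s t c
    have := tsum_subtype (letterSet i n s t) (fun _ => c)
    rw [ENNReal.tsum_set_const, ← numLet_eq_encard] at this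
    simpa [Set.indicator] using this
  have h2 : ∀ m, q ^ (m + 1) * heightGF x m w = ∑' l : List ℕ, if l ∈ heightSet m then
      q ^ (m + 1) * (x ^ l.length * w ^ l.count 0) else 0 := by
    intro m
    rw [heightGF, ← ENNReal.tsum_mul_left, tsum_subtype (heightSet m)
      (fun l => q ^ (m + 1) * (x ^ l.length * w ^ l.count 0))]
    simp [Set.indicator]
  simp_rw [mul_assoc (numLet _ _ _ _ : ℝ≥0∞), h1, h2]
  rw [ENNReal.tsum_comm, ENNReal.tsum_comm (α := ℕ), ← ENNReal.tsum_mul_left]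
  refine tsum_congr fun l => ?_
  simpa [mul_assoc, ← ENNReal.tsum_mul_left] using tsum_ite_letterSet x w q l

lemma chainGF_ofReal {U : ℤ → ℝ} {s : ℝ} (hs : 0 < s) (h0 : U 0 = 1) (h1 : U (-1) = 0)
    (hU : ∀ n, s * U (n + 2) = U (n + 1) - s * U n) (k : ℕ) {w : ℝ} (hw : 0 < w)
    (hd : ∀ j : ℕ, j ≤ k → 0 < U (j + 1) - w * s * U j) :
    chainGF (ENNReal.ofReal (s ^ 2)) k (ENNReal.ofReal w) =
      ENNReal.ofReal (w * s / ((U (k + 1) - w * s * U k) * (U k - w * s * U (k - 1)))) := by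
  have hU1 : s * U 1 = 1 := by
    have := hU (-1)
    norm_num [h0, h1] at this
    exact this
  have hpos : ∀ w : ℝ, 0 < U 1 - w * s → 0 < 1 - w * s ^ 2 := fun w h => by
    have := mul_pos hs h
    nlinarith
  have hinv : ∀ w : ℝ, 0 < w → 0 < 1 - w * s ^ 2 →
      (1 - ENNReal.ofReal w * ENNReal.ofReal (s ^ 2))⁻¹ =
        ENNReal.ofReal (1 - w * s ^ 2)⁻¹ := fun w hw h => by
    rw [← ENNReal.ofReal_mul hw.le, ← ENNReal.ofReal_one,
      ← ENNReal.ofReal_sub _ (by positivity), ENNReal.ofReal_inv_of_pos h]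
  have hρ : ∀ w : ℝ, 0 < w → 0 < 1 - w * s ^ 2 →
      ENNReal.ofReal w * ENNReal.ofReal (s ^ 2) *
        (1 - ENNReal.ofReal w * ENNReal.ofReal (s ^ 2))⁻¹ =
        ENNReal.ofReal (w * s ^ 2 * (1 - w * s ^ 2)⁻¹) := fun w hw h => by
    rw [hinv w hw h, ← ENNReal.ofReal_mul hw.le, ← ENNReal.ofReal_mul (by positivity)]
  have hU1' : U 1 = 1 / s := by field_simp; linarith
  induction k generalizing w with
  | zero =>
    have h2 := hd 0 le_rfl
    simp only [Nat.cast_zero, zero_add, h0, mul_one] at h2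
    have h3 := hpos w h2
    rw [chainGF, hρ w hw h3]
    congr 1
    simp only [Nat.cast_zero, zero_add, h0, mul_one, zero_sub, h1, mul_zero, sub_zero, hU1']
    rw [show 1 / s - w * s = (1 - w * s ^ 2) / s by field_simp]
    field_simp
  | succ k ih =>
    have h2 := hd 0 (Nat.zero_le _)
    simp only [Nat.cast_zero, zero_add, h0, mul_one] at h2
    have h3 := hpos w h2
    have key : ∀ n : ℤ, U (n + 1) - (1 - w * s ^ 2)⁻¹ * s * U n =
        s * (U (n + 2) - w * s * U (n + 1)) * (1 - w * s ^ 2)⁻¹ := fun n => by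
      have := hU n
      field_simp
      linear_combination (-1 : ℝ) * this
    rw [chainGF, hρ w hw h3, hinv w hw h3, ih (inv_pos.2 h3), ← ENNReal.ofReal_mul (by positivity)]
    · congr 1
      have h4 := key k
      have h5 := key (k - 1)
      have e1 : (k : ℤ) - 1 + 1 = k := by ring
      have e2 : (k : ℤ) - 1 + 2 = k + 1 := by ring
      have e3 : (k : ℤ) + 1 + 1 = k + 2 := by ring
      have e4 : (k : ℤ) + 1 - 1 = k := by ring
      rw [e1, e2] at h5
      push_cast
      rw [h4, h5, e3, e4]
      field_simp
    · intro j hj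
      have h4 := hd (j + 1) (by omega)
      push_cast at h4
      rw [show (j : ℤ) + 1 + 1 = j + 2 by ring] at h4
      rw [key]
      exact mul_pos (mul_pos hs h4) (inv_pos.2 h3)

lemma one_le_and_le_succ_of_recurrence {U : ℤ → ℝ} {s : ℝ} (hs : 0 < s) (hs2 : s < 1 / 2)
    (h0 : U 0 = 1) (h1 : U (-1) = 0) (hU : ∀ n, s * U (n + 2) = U (n + 1) - s * U n) (n : ℕ) :
    1 ≤ U n ∧ U n ≤ U (n + 1) := by
  induction n with
  | zero =>
    have := hU (-1)
    norm_num [h0, h1] at this ⊢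
    nlinarith
  | succ n ih =>
    have := hU n
    push_cast
    rw [show (n : ℤ) + 1 + 1 = n + 2 by ring]
    refine ⟨ih.1.trans ih.2, ?_⟩
    nlinarith

lemma tsum_chainGF_ofReal {U : ℤ → ℝ} {s w q : ℝ} (hs : 0 < s) (hs2 : s < 1 / 2)
    (h0 : U 0 = 1) (h1 : U (-1) = 0) (hU : ∀ n, s * U (n + 2) = U (n + 1) - s * U n)
    (hw : 0 < w) (hw1 : w ≤ 1) (hq0 : 0 < q) (hq1 : q < 1) :
    ∑' m, ENNReal.ofReal q ^ (m + 1) *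
        chainGF (ENNReal.ofReal (s ^ 2)) m (ENNReal.ofReal w) =
      ENNReal.ofReal (q * ∑' j : ℕ, w * s * q ^ j /
        ((U (j + 1) - w * s * U j) * (U j - w * s * U (j - 1)))) ∧
    0 ≤ q * ∑' j : ℕ, w * s * q ^ j /
        ((U (j + 1) - w * s * U j) * (U j - w * s * U (j - 1))) := by
  have hmono := one_le_and_le_succ_of_recurrence hs hs2 h0 h1 hU
  have hws : w * s ≤ 1 / 2 := by nlinarith
  have hd : ∀ j : ℕ, 1 / 2 ≤ U (j + 1) - w * s * U j := fun j => by
    obtain ⟨h2, h3⟩ := hmono j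
    nlinarith
  have hd' : ∀ j : ℕ, 1 / 2 ≤ U j - w * s * U (j - 1) := fun j => by
    cases j with
    | zero => norm_num [h0, h1]
    | succ j => simpa using hd j
  have hprod : ∀ j : ℕ, 1 / 4 ≤ (U (j + 1) - w * s * U j) * (U j - w * s * U (j - 1)) :=
    fun j => by nlinarith [hd j, hd' j]
  have hnonneg : ∀ j : ℕ, 0 ≤ q * (w * s * q ^ j /
      ((U (j + 1) - w * s * U j) * (U j - w * s * U (j - 1)))) := fun j => by
    have := (by norm_num : (0 : ℝ) < 1 / 4).trans_le (hprod j)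
    positivity
  have hsum : Summable fun j : ℕ => q * (w * s * q ^ j /
      ((U (j + 1) - w * s * U j) * (U j - w * s * U (j - 1)))) := by
    refine Summable.of_nonneg_of_le hnonneg (fun j => ?_)
      ((summable_geometric_of_lt_one hq0.le hq1).mul_left (q * 2))
    rw [mul_assoc q]
    refine mul_le_mul_of_nonneg_left ?_ hq0.le
    have h4 := hprod j
    rw [div_le_iff₀ (by linarith)]
    have : 0 < q ^ j := by positivity
    nlinarith
  rw [← tsum_mul_left]
  refine ⟨?_, tsum_nonneg hnonneg⟩
  rw [ENNReal.ofReal_tsum_of_nonneg hnonneg hsum]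
  refine tsum_congr fun j => ?_
  rw [chainGF_ofReal hs h0 h1 hU j hw fun i _ => by linarith [hd i],
    ← ENNReal.ofReal_pow hq0.le, ← ENNReal.ofReal_mul (by positivity)]
  congr 1
  ring

lemma mul_chebU_add_two {s : ℝ} (hs : 0 < s) (n : ℤ) :
    s * chebU (n + 2) (1 / (2 * s)) =
      chebU (n + 1) (1 / (2 * s)) - s * chebU n (1 / (2 * s)) := by
  simp only [chebU, Polynomial.Chebyshev.U_add_two, Polynomial.eval_sub, Polynomial.eval_mul,
    Polynomial.eval_ofNat, Polynomial.eval_X]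
  field_simp

/-- Closed form for the triple series
`Σ_{i≥1} Σ_{t≥1} Σ_{n≥t} aᵢ(n,0,t) xⁿ wᵗ qⁱ` (indexed here by `(i,t,k) : ℕ³` via
`i ↦ i+1`, `t ↦ t+1`, `n = t + k`), in terms of Chebyshev polynomials evaluated at
`t₀ = 1/(2√x)`. -/
theorem triple_series_closed_form (x w q : ℝ) (hx0 : 0 < x) (hx : x < 1/4)
    (hw0 : 0 < w) (hw1 : w ≤ 1) (hq0 : 0 < q) (hq1 : q < 1) :
    let t₀ : ℝ := 1 / (2 * Real.sqrt x);
    Summable (fun p : ℕ × ℕ × ℕ =>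
      (numLet (p.1 + 1) (p.2.1 + 1 + p.2.2) 0 (p.2.1 + 1) : ℝ) * x ^ (p.2.1 + 1 + p.2.2) *
        w ^ (p.2.1 + 1) * q ^ (p.1 + 1)) ∧
    ∑' p : ℕ × ℕ × ℕ,
      (numLet (p.1 + 1) (p.2.1 + 1 + p.2.2) 0 (p.2.1 + 1) : ℝ) * x ^ (p.2.1 + 1 + p.2.2) *
        w ^ (p.2.1 + 1) * q ^ (p.1 + 1) =
      (q * ∑' j : ℕ, w * Real.sqrt x * q ^ j /
          ((chebU ((j : ℤ) + 1) t₀ - w * Real.sqrt x * chebU (j : ℤ) t₀) *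
            (chebU (j : ℤ) t₀ - w * Real.sqrt x * chebU ((j : ℤ) - 1) t₀))) /
        ((1 - q) * (1 + q * ∑' j : ℕ, q ^ j /
          (Real.sqrt x * chebU ((j : ℤ) + 2) t₀ * chebU ((j : ℤ) + 1) t₀))) := by
  intro t₀
  have hs : 0 < √x := Real.sqrt_pos.2 hx0
  have hs2 : √x < 1 / 2 := by
    rw [Real.sqrt_lt' (by norm_num)]
    linarith
  have hsq : √x ^ 2 = x := Real.sq_sqrt hx0.le
  have h0 : chebU 0 t₀ = 1 := by simp [chebU]
  have h1 : chebU (-1) t₀ = 0 := by simp [chebU]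
  have hU : ∀ n, √x * chebU (n + 2) t₀ = chebU (n + 1) t₀ - √x * chebU n t₀ :=
    mul_chebU_add_two hs
  obtain ⟨hA, hA0⟩ := tsum_chainGF_ofReal (U := fun n => chebU n t₀) hs hs2 h0 h1 hU
    hw0 hw1 hq0 hq1
  obtain ⟨hA', hA0'⟩ := tsum_chainGF_ofReal (U := fun n => chebU n t₀) hs hs2 h0 h1 hU
    one_pos le_rfl hq0 hq1
  have hcongr : ∀ j : ℕ, 1 * √x * q ^ j / ((chebU (j + 1) t₀ - 1 * √x * chebU j t₀) *
      (chebU j t₀ - 1 * √x * chebU (j - 1) t₀)) =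
      q ^ j / (√x * chebU ((j : ℤ) + 2) t₀ * chebU ((j : ℤ) + 1) t₀) := fun j => by
    have h2 := hU (j - 1)
    rw [show (j : ℤ) - 1 + 2 = j + 1 by ring, show (j : ℤ) - 1 + 1 = j by ring] at h2
    rw [one_mul, ← hU, ← h2]
    field_simp
  simp only [hcongr, hsq, ENNReal.ofReal_one] at hA hA' hA0'
  set a := q * ∑' j : ℕ, w * √x * q ^ j / ((chebU ((j : ℤ) + 1) t₀ - w * √x * chebU (j : ℤ) t₀) *
    (chebU (j : ℤ) t₀ - w * √x * chebU ((j : ℤ) - 1) t₀))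
  set a' := q * ∑' j : ℕ, q ^ j / (√x * chebU ((j : ℤ) + 2) t₀ * chebU ((j : ℤ) + 1) t₀)
  have hB := tsum_heightGF (ENNReal.ofReal x) (ENNReal.ofReal q) (ENNReal.ofReal w)
  have hB' := tsum_heightGF (ENNReal.ofReal x) (ENNReal.ofReal q) 1
  have hT := tsum_numLet (ENNReal.ofReal x) (ENNReal.ofReal w) (ENNReal.ofReal q)
  rw [hA] at hB
  rw [hA'] at hB'
  set B := ∑' m, ENNReal.ofReal q ^ (m + 1) * heightGF (ENNReal.ofReal x) m (ENNReal.ofReal w)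
  set B' := ∑' m, ENNReal.ofReal q ^ (m + 1) * heightGF (ENNReal.ofReal x) m 1
  have hBfin : B ≠ ⊤ := ne_top_of_le_ne_top ENNReal.ofReal_ne_top (hB ▸ le_self_add)
  have hBfin' : B' ≠ ⊤ := ne_top_of_le_ne_top ENNReal.ofReal_ne_top (hB' ▸ le_self_add)
  have hb : B.toReal + a * B'.toReal = a := by
    have := congrArg ENNReal.toReal hB
    rwa [ENNReal.toReal_add hBfin (ENNReal.mul_ne_top ENNReal.ofReal_ne_top hBfin'),
      ENNReal.toReal_mul, ENNReal.toReal_ofReal hA0] at this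
  have hb' : B'.toReal + a' * B'.toReal = a' := by
    have := congrArg ENNReal.toReal hB'
    rwa [ENNReal.toReal_add hBfin' (ENNReal.mul_ne_top ENNReal.ofReal_ne_top hBfin'),
      ENNReal.toReal_mul, ENNReal.toReal_ofReal hA0'] at this
  have hq : (1 - ENNReal.ofReal q)⁻¹ = ENNReal.ofReal (1 - q)⁻¹ := by
    rw [← ENNReal.ofReal_one, ← ENNReal.ofReal_sub _ hq0.le,
      ENNReal.ofReal_inv_of_pos (by linarith)]
  have hTfin : (1 - ENNReal.ofReal q)⁻¹ * B ≠ ⊤ :=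
    hq ▸ ENNReal.mul_ne_top ENNReal.ofReal_ne_top hBfin
  have hterm : ∀ p : ℕ × ℕ × ℕ,
      (numLet (p.1 + 1) (p.2.1 + 1 + p.2.2) 0 (p.2.1 + 1) : ℝ) * x ^ (p.2.1 + 1 + p.2.2) *
        w ^ (p.2.1 + 1) * q ^ (p.1 + 1) =
      ((numLet (p.1 + 1) (p.2.1 + 1 + p.2.2) 0 (p.2.1 + 1) : ℝ≥0∞) *
        ENNReal.ofReal x ^ (p.2.1 + 1 + p.2.2) * ENNReal.ofReal w ^ (p.2.1 + 1) *
        ENNReal.ofReal q ^ (p.1 + 1)).toReal := fun p => by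
    simp [hx0.le, hw0.le, hq0.le]
  simp only [hterm]
  rw [← hT] at hTfin
  refine ⟨ENNReal.summable_toReal hTfin, ?_⟩
  rw [← ENNReal.tsum_toReal_eq (ENNReal.ne_top_of_tsum_ne_top hTfin), hT, hq,
    ENNReal.toReal_mul, ENNReal.toReal_ofReal (inv_nonneg.2 (by linarith))]
  have hq' : 0 < 1 - q := by linarith
  have ha' : 0 < 1 + a' := by linarith
  field_simp
  linear_combination (1 + a') * hb - a * hb'
end
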